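/- arXiv:2604.27483 — 5 statements merged into one kernel-verified Lean document; each statement's English description precedes it below -/
import Mathlib

section
/- Let r be an even integer, k an odd integer, and λ a positive integer with (1/λ)·r ≤ k ≤ (1 − 1/λ)·r. Then every λ-edge-connected r-regular multigraph G with k·|V(G)| even has a k-factor. -/
open Finset

/-! ### Multigraphs

A (finite, loopless) multigraph on a vertex type `V` is given by an edge-index type `ε`
together with an endpoint map `ends : ε → Sym2 V`; looplessness is the condition
`∀ e, ¬ (ends e).IsDiag`.  Multiple edges are allowed: distinct indices may have the
same endpoints. -/

section Multigraph

variable {V : Type} [Fintype V] [DecidableEq V] {ε : Type} [Fintype ε]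

/-- The degree of a vertex in a multigraph. -/
def mdeg (ends : ε → Sym2 V) (v : V) : ℕ :=
  (Finset.univ.filter fun e => v ∈ ends e).card

/-- The degree of a vertex in the spanning subgraph with edge set `F`. -/
def mdegIn (ends : ε → Sym2 V) (F : Finset ε) (v : V) : ℕ :=
  (F.filter fun e => v ∈ ends e).card

/-- `e_G(A, B)`: the number of edges with one endvertex in `A` and the other in `B`
(for disjoint `A`, `B`). -/
def eM (ends : ε → Sym2 V) (A B : Finset V) : ℕ :=
  (Finset.univ.filter fun e => ∃ a ∈ A, ∃ b ∈ B, ends e = s(a, b)).card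

/-- A multigraph is `r`-regular if every vertex has degree `r`. -/
def MRegular (ends : ε → Sym2 V) (r : ℕ) : Prop :=
  ∀ v : V, mdeg ends v = r

/-- A `k`-factor: a spanning subgraph (an edge set `F`) in which every vertex has degree `k`. -/
def HasKFactor (ends : ε → Sym2 V) (k : ℕ) : Prop :=
  ∃ F : Finset ε, ∀ v : V, mdegIn ends F v = k

/-- The multigraph restricted to the edge set `E'` is connected: every two vertices are
joined by a walk (equivalently, by a path). -/
def MConnected (ends : ε → Sym2 V) (E' : Finset ε) : Prop :=
  ∀ u v : V, Relation.ReflTransGen (fun a b => ∃ e ∈ E', ends e = s(a, b)) u v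

/-- A multigraph is `lam`-edge-connected if removing any set of at most `lam - 1`
edges leaves it connected. -/
def MEdgeConnected [DecidableEq ε] (ends : ε → Sym2 V) (lam : ℕ) : Prop :=
  ∀ F : Finset ε, F.card ≤ lam - 1 → MConnected ends (Finset.univ \ F)

/-- Reachability within the vertex set `A` (both endpoints of every step lie in `A`). -/
def MReachIn (ends : ε → Sym2 V) (A : Finset V) (u v : V) : Prop :=
  Relation.ReflTransGen (fun a b => a ∈ A ∧ b ∈ A ∧ ∃ e : ε, ends e = s(a, b)) u v

open scoped Classical in
/-- `D` is (the vertex set of) a connected component of the subgraph of the multigraph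
induced on the vertex set `A`. -/
def MIsComp (ends : ε → Sym2 V) (A D : Finset V) : Prop :=
  ∃ v ∈ A, D = A.filter (MReachIn ends A v)

/-- `q(S, T)`: the number of components `D` of `G - (S ∪ T)` with
`f(D) + e_G(D, T)` odd (the `f`-odd components). -/
noncomputable def qST (ends : ε → Sym2 V) (f : V → ℤ) (S T : Finset V) : ℕ :=
  Nat.card {D : Finset V // MIsComp ends (Finset.univ \ (S ∪ T)) D ∧
    Odd ((∑ v ∈ D, f v) + (eM ends D T : ℤ))}

/-- `η(S, T) = f(S) + deg_G(T) − g(T) − e_G(S, T) − q(S, T)`. -/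
noncomputable def eta (ends : ε → Sym2 V) (g f : V → ℤ) (S T : Finset V) : ℤ :=
  (∑ v ∈ S, f v) + (∑ v ∈ T, (mdeg ends v : ℤ)) - (∑ v ∈ T, g v)
    - (eM ends S T : ℤ) - (qST ends f S T : ℤ)

/-- A parity `(g, f)`-factor: a spanning subgraph `F` with
`g(v) ≤ deg_F(v) ≤ f(v)` and `deg_F(v) ≡ f(v) (mod 2)` for every vertex `v`. -/
def HasParityFactor (ends : ε → Sym2 V) (g f : V → ℤ) : Prop :=
  ∃ F : Finset ε, ∀ v : V,
    g v ≤ (mdegIn ends F v : ℤ) ∧ (mdegIn ends F v : ℤ) ≤ f v ∧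
      (mdegIn ends F v : ℤ) ≡ f v [ZMOD 2]

end Multigraph

/-! ### Hypergraphs

A hypergraph on a finite vertex type `V` is given by an edge-index type `ε` together with
a map `edges : ε → Finset V`; every edge is required to have at least two vertices
(a hypothesis in the theorems below).  Multiple edges are allowed: distinct indices may
carry the same vertex set. -/

section Hypergraph

variable {V : Type} [Fintype V] [DecidableEq V] {ε : Type} [Fintype ε]

/-- The degree of a vertex `v` in a hypergraph: the number of edges containing `v`. -/
def hdeg (edges : ε → Finset V) (v : V) : ℕ :=
  (Finset.univ.filter fun e => v ∈ edges e).card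

/-- `vs = [v₁, …, v_{l+1}]`, `es = [e₁, …, e_l]` form a Berge path (distinct vertices,
distinct edges, `{vᵢ, vᵢ₊₁} ⊆ eᵢ`) using hyperedges from `E'`. -/
def IsBergePath (edges : ε → Finset V) (E' : Finset ε) (vs : List V) (es : List ε) : Prop :=
  vs.Nodup ∧ es.Nodup ∧ vs.length = es.length + 1 ∧
  ∀ i : ℕ, (hi : i < es.length) → (hv : i + 1 < vs.length) →
    es[i] ∈ E' ∧ vs[i]'(Nat.lt_of_succ_lt hv) ∈ edges es[i] ∧ vs[i + 1] ∈ edges es[i]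

/-- The hypergraph restricted to the edge set `E'` is connected: every two vertices are
joined by a Berge path. -/
def HConnected (edges : ε → Finset V) (E' : Finset ε) : Prop :=
  ∀ u v : V, ∃ vs es, IsBergePath edges E' vs es ∧ vs.head? = some u ∧ vs.getLast? = some v

/-- A hypergraph is `lam`-edge-connected if removing any set of at most `lam - 1`
edges leaves it connected. -/
def HEdgeConnected [DecidableEq ε] (edges : ε → Finset V) (lam : ℕ) : Prop :=
  ∀ F : Finset ε, F.card ≤ lam - 1 → HConnected edges (Finset.univ \ F)

/-- A Berge `k`-factor of the hypergraph: a spanning subhypergraph (an edge set `E'`)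
which is Berge-`G` for some `k`-regular (multi)graph `G` on the same vertex set, i.e.
there are a loopless multigraph `G` (with edge-index type `Fin n` and endpoint map
`ends`) which is `k`-regular, and a bijection `φ` from the edges of `G` to `E'` such
that every edge of `G` is contained in the corresponding hyperedge. -/
def HasBergeKFactor (edges : ε → Finset V) (k : ℕ) : Prop :=
  ∃ (E' : Finset ε) (n : ℕ) (ends : Fin n → Sym2 V) (φ : Fin n ≃ {e // e ∈ E'}),
    (∀ g, ¬ (ends g).IsDiag) ∧
    (∀ v : V, (Finset.univ.filter fun g => v ∈ ends g).card = k) ∧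
    (∀ g : Fin n, ∀ x ∈ ends g, x ∈ edges (φ g).1)

/-- The incidence graph of a hypergraph: the bipartite simple graph on `V ⊕ ε` in which
a vertex `v` and a hyperedge `e` are adjacent iff `v ∈ e`. -/
def incGraph (edges : ε → Finset V) : SimpleGraph (V ⊕ ε) where
  Adj a b := (∃ v e, a = Sum.inl v ∧ b = Sum.inr e ∧ v ∈ edges e) ∨
             (∃ v e, a = Sum.inr e ∧ b = Sum.inl v ∧ v ∈ edges e)
  symm := by
    constructor
    rintro a b (⟨v, e, rfl, rfl, h⟩ | ⟨v, e, rfl, rfl, h⟩)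
    · exact Or.inr ⟨v, e, rfl, rfl, h⟩
    · exact Or.inl ⟨v, e, rfl, rfl, h⟩
  loopless := by
    constructor
    rintro a (⟨v, e, rfl, h, -⟩ | ⟨v, e, rfl, h, -⟩) <;> simp at h

end Hypergraph

/-! ### Simple graphs: edge counts, components, parity factors -/

section SimpleGraphAux

variable {W : Type} [Fintype W] [DecidableEq W]

open scoped Classical in
/-- The number of edges of a simple graph with one endvertex in `A` and the other in `B`
(for disjoint `A`, `B`). -/
noncomputable def eSG (G : SimpleGraph W) (A B : Finset W) : ℕ :=
  ((A ×ˢ B).filter fun p => G.Adj p.1 p.2).card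

/-- Reachability within the vertex set `A` in a simple graph. -/
def SReachIn (G : SimpleGraph W) (A : Finset W) (u v : W) : Prop :=
  Relation.ReflTransGen (fun a b => a ∈ A ∧ b ∈ A ∧ G.Adj a b) u v

open scoped Classical in
/-- `D` is (the vertex set of) a connected component of the subgraph induced on `A`. -/
def SIsComp (G : SimpleGraph W) (A D : Finset W) : Prop :=
  ∃ v ∈ A, D = A.filter (SReachIn G A v)

/-- A parity `(g, f)`-factor of a simple graph: a spanning subgraph `F` (a set of edges)
with `g(v) ≤ deg_F(v) ≤ f(v)` and `deg_F(v) ≡ f(v) (mod 2)` for every vertex `v`. -/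
def HasParityFactorSG (G : SimpleGraph W) (g f : W → ℤ) : Prop :=
  ∃ F : Finset (Sym2 W), (∀ x ∈ F, x ∈ G.edgeSet) ∧
    ∀ v : W, g v ≤ ((F.filter fun x => v ∈ x).card : ℤ) ∧
      ((F.filter fun x => v ∈ x).card : ℤ) ≤ f v ∧
      ((F.filter fun x => v ∈ x).card : ℤ) ≡ f v [ZMOD 2]

end SimpleGraphAux

lemma tutte_weighted {W : Type} [Fintype W] [DecidableEq W] (w : W → W → ℕ)
    (hs : ∀ x y, w x y = w y x) (h0 : ∀ x, w x x = 0) (r : ℕ) (hr : 0 < r)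
    (hrow : ∀ x, ∑ y, w x y = r)
    (hcut : ∀ C : Finset W, Odd C.card →
      2 * r ≤ ∑ x, ∑ y, if (x ∈ C ↔ y ∈ C) then 0 else w x y) :
    ∃ f : W → W, (∀ x, f (f x) = x) ∧ ∀ x, w x (f x) ≠ 0 := by
  classical
  let G : SimpleGraph W :=
    { Adj := fun x y => w x y ≠ 0
      symm := ⟨fun x y h => by rw [hs]; exact h⟩
      loopless := ⟨fun x h => h (h0 x)⟩ }
  have hcut' : ∀ C : Finset W, Odd C.card → r ≤ ∑ x ∈ C, ∑ y ∈ Cᶜ, w x y := by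
    intro C hC
    have h1 := hcut C hC
    have h2 : ∑ x, ∑ y, (if (x ∈ C ↔ y ∈ C) then 0 else w x y)
        = ∑ x ∈ C, ∑ y ∈ Cᶜ, w x y + ∑ x ∈ Cᶜ, ∑ y ∈ C, w x y := by
      rw [← Finset.sum_add_sum_compl C]
      congr 1
      · refine Finset.sum_congr rfl fun x hx => ?_
        rw [← Finset.sum_add_sum_compl C]
        rw [Finset.sum_eq_zero (s := C) (by intro y hy; simp [hx, hy]), zero_add]
        refine Finset.sum_congr rfl fun y hy => ?_
        rw [Finset.mem_compl] at hy
        simp [hx, hy]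
      · refine Finset.sum_congr rfl fun x hx => ?_
        rw [Finset.mem_compl] at hx
        rw [← Finset.sum_add_sum_compl C]
        rw [Finset.sum_eq_zero (s := Cᶜ)
          (by intro y hy; rw [Finset.mem_compl] at hy; simp [hx, hy]), add_zero]
        refine Finset.sum_congr rfl fun y hy => ?_
        simp [hx, hy]
    have h3 : ∑ x ∈ Cᶜ, ∑ y ∈ C, w x y = ∑ x ∈ C, ∑ y ∈ Cᶜ, w x y := by
      rw [Finset.sum_comm]
      exact Finset.sum_congr rfl fun x _ => Finset.sum_congr rfl fun y _ => hs _ _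
    omega
  have hT : ∃ M : G.Subgraph, M.IsPerfectMatching := by
    rw [SimpleGraph.tutte]
    intro u hu
    unfold SimpleGraph.IsTutteViolator at hu
    set H := ((⊤ : G.Subgraph).deleteVerts u).coe with hH
    let S : H.ConnectedComponent → Finset W := fun c => (Subtype.val '' c.supp).toFinset
    have hScard : ∀ c ∈ H.oddComponents, Odd (S c).card := by
      intro c hc
      have : (S c).card = c.supp.ncard := by
        rw [← Set.ncard_eq_toFinset_card', Set.ncard_image_of_injective _ Subtype.val_injective]
      rw [this]; exact hc
    have hmem : ∀ c x, x ∈ S c ↔ ∃ h, (⟨x, h⟩ : ((⊤ : G.Subgraph).deleteVerts u).verts) ∈ c.supp := by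
      intro c x
      simp [S]
    have hbd : ∀ c ∈ H.oddComponents, r ≤ ∑ x ∈ S c, ∑ y ∈ u.toFinset, w x y := by
      intro c hc
      refine (hcut' _ (hScard c hc)).trans (Finset.sum_le_sum fun x hx => ?_)
      apply Finset.sum_le_sum_of_ne_zero
      intro y hy hxy
      rw [Set.mem_toFinset]
      by_contra hyu
      rw [Finset.mem_compl] at hy
      apply hy
      rw [hmem] at hx ⊢
      obtain ⟨h, hx⟩ := hx
      have hyv : y ∈ ((⊤ : G.Subgraph).deleteVerts u).verts := by simp [hyu]
      refine ⟨hyv, ?_⟩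
      refine (c.mem_supp_congr_adj ?_).1 hx
      have hxu : x ∉ u := by simpa using h
      simp only [hH, SimpleGraph.Subgraph.coe_adj, SimpleGraph.Subgraph.deleteVerts_adj]
      simp [hxu, hyu, G, hxy]
    have hdisj : ∀ c d, c ≠ d → Disjoint (S c) (S d) := by
      intro c d hcd
      rw [Finset.disjoint_left]
      intro x hx hx'
      rw [hmem] at hx hx'
      obtain ⟨h, hx⟩ := hx
      obtain ⟨h', hx'⟩ := hx'
      exact hcd (hx.symm.trans hx')
    have hfin : H.oddComponents.Finite := Set.toFinite _
    have hge : r * H.oddComponents.ncard ≤ r * u.ncard := by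
      calc r * H.oddComponents.ncard = ∑ c ∈ hfin.toFinset, r := by
            rw [Set.ncard_eq_toFinset_card _ hfin]; simp [mul_comm]
        _ ≤ ∑ c ∈ hfin.toFinset, ∑ x ∈ S c, ∑ y ∈ u.toFinset, w x y :=
            Finset.sum_le_sum fun c hc => hbd c (by simpa using hc)
        _ = ∑ x ∈ hfin.toFinset.biUnion S, ∑ y ∈ u.toFinset, w x y := by
            rw [Finset.sum_biUnion]
            intro c _ d _ hcd
            exact hdisj c d hcd
        _ ≤ ∑ x, ∑ y ∈ u.toFinset, w x y :=
            Finset.sum_le_sum_of_subset (Finset.subset_univ _)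
        _ = ∑ y ∈ u.toFinset, ∑ x, w y x := by
            rw [Finset.sum_comm]
            exact Finset.sum_congr rfl fun x _ => Finset.sum_congr rfl fun y _ => hs _ _
        _ = r * u.ncard := by
            rw [Finset.sum_congr rfl fun x _ => hrow x, Set.ncard_eq_toFinset_card']
            simp [mul_comm]
    exact absurd (Nat.le_of_mul_le_mul_left hge hr) (not_le.2 hu)
  obtain ⟨M, hM⟩ := hT
  rw [SimpleGraph.Subgraph.isPerfectMatching_iff] at hM
  choose f hf hf' using hM
  refine ⟨f, fun x => ?_, fun x => ?_⟩
  · exact (hf' _ _ (hf x).symm).symm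
  · exact (hf x).adj_sub

/-- Vertex at which a half edge sits. -/
def vtx {V ε : Type} (p q : ε → V) (h : ε × Bool) : V := if h.2 then p h.1 else q h.1

/-- Edge weights of the gadget graph. -/
def gw {V ε : Type} [DecidableEq V] [DecidableEq ε] (p q : ε → V) (k m : ℕ) :
    (ε × Bool) ⊕ (V × Fin m) → (ε × Bool) ⊕ (V × Fin m) → ℕ
  | .inl h, .inl h' => if h' = (h.1, !h.2) then k else 0
  | .inl h, .inr v => if vtx p q h = v.1 then 1 else 0
  | .inr v, .inl h => if vtx p q h = v.1 then 1 else 0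
  | .inr _, .inr _ => 0

lemma gw_symm {V ε : Type} [DecidableEq V] [DecidableEq ε] (p q : ε → V) (k m : ℕ) (x y) :
    gw p q k m x y = gw p q k m y x := by
  rcases x with ⟨e, b⟩ | x <;> rcases y with ⟨e', b'⟩ | y <;> simp only [gw]
  congr 1
  simp only [Prod.mk.injEq, eq_iff_iff]
  cases b <;> cases b' <;> simp [eq_comm]

lemma gw_self {V ε : Type} [DecidableEq V] [DecidableEq ε] (p q : ε → V) (k m : ℕ) (x) :
    gw p q k m x x = 0 := by
  rcases x with ⟨e, b⟩ | x <;> simp [gw]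

lemma gw_row {V ε : Type} [Fintype V] [Fintype ε] [DecidableEq V] [DecidableEq ε]
    (p q : ε → V) (k m r : ℕ) (hr : k + m = r)
    (hdeg : ∀ v, (univ.filter fun h : ε × Bool => vtx p q h = v).card = r) (x) :
    ∑ y, gw p q k m x y = r := by
  rcases x with h | ⟨v, i⟩
  · rw [Fintype.sum_sum_type]
    simp only [gw]
    rw [Finset.sum_ite_eq' univ, Fintype.sum_prod_type, Finset.sum_comm]
    simp [hr]
  · rw [Fintype.sum_sum_type]
    simp only [gw]
    simp [hdeg]

lemma gw_cut {V ε : Type} [Fintype V] [Fintype ε] [DecidableEq V] [DecidableEq ε]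
    (p q : ε → V) (k m r lam : ℕ) (hr : k + m = r) (hm : 0 < m)
    (hmV : Even (Fintype.card V)) (hk : r ≤ k * lam) (hml : r ≤ m * lam)
    (hdeg : ∀ v, (univ.filter fun h : ε × Bool => vtx p q h = v).card = r)
    (hlam : ∀ D : Finset V, D.Nonempty → D ≠ univ →
      lam ≤ (univ.filter fun e => ¬ (p e ∈ D ↔ q e ∈ D)).card)
    (C : Finset ((ε × Bool) ⊕ (V × Fin m))) (hC : Odd C.card) :
    2 * r ≤ ∑ x, ∑ y, if (x ∈ C ↔ y ∈ C) then 0 else gw p q k m x y := by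
  classical
  let c : (ε × Bool) → ℕ := fun h => if (.inl h ∈ C ↔ .inl (h.1, !h.2) ∈ C) then 0 else k
  let d : (ε × Bool) → ℕ := fun h =>
    (univ.filter fun i : Fin m => ¬ (.inl h ∈ C ↔ .inr (vtx p q h, i) ∈ C)).card
  have key : (∑ x, ∑ y, if (x ∈ C ↔ y ∈ C) then 0 else gw p q k m x y)
      = ∑ h, (c h + 2 * d h) := by
    have hd : ∀ h, (∑ y : V × Fin m, if (Sum.inl h ∈ C ↔ Sum.inr y ∈ C) then 0
        else if vtx p q h = y.1 then 1 else 0) = d h := by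
      intro h
      rw [Fintype.sum_prod_type, Finset.sum_eq_single (vtx p q h)]
      · simp only [d, Finset.card_filter]
        refine Finset.sum_congr rfl fun i _ => ?_
        by_cases hh : (Sum.inl h ∈ C ↔ Sum.inr (vtx p q h, i) ∈ C) <;> simp [hh]
      · intro v _ hv
        simp [hv.symm]
      · simp
    rw [Fintype.sum_sum_type]
    have h1 : ∀ h, (∑ y, if (Sum.inl h ∈ C ↔ y ∈ C) then 0 else gw p q k m (Sum.inl h) y)
        = c h + d h := by
      intro h
      rw [Fintype.sum_sum_type]
      simp only [gw]
      rw [hd]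
      congr 1
      rw [Finset.sum_eq_single (h.1, !h.2)]
      · simp [c]
      · intro y _ hy; simp [hy]
      · simp
    have h2 : (∑ x : V × Fin m, ∑ y, if (Sum.inr x ∈ C ↔ y ∈ C) then 0
        else gw p q k m (Sum.inr x) y) = ∑ h, d h := by
      simp only [Fintype.sum_sum_type, gw, ite_self, Finset.sum_const_zero, add_zero]
      rw [Finset.sum_comm]
      refine Finset.sum_congr rfl fun h _ => ?_
      rw [← hd]
      refine Finset.sum_congr rfl fun y _ => ?_
      simp only [iff_comm]
    rw [h2, Finset.sum_congr rfl fun h _ => h1 h, ← Finset.sum_add_distrib]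
    refine Finset.sum_congr rfl fun h _ => ?_
    ring
  rw [key]
  by_cases hsplit : ∃ v i j, (Sum.inr (v, i) ∈ C) ∧ (Sum.inr (v, j) ∉ C)
  · obtain ⟨v, i, j, hi, hj⟩ := hsplit
    calc 2 * r = ∑ h ∈ univ.filter (fun h : ε × Bool => vtx p q h = v), 2 := by
          rw [Finset.sum_const, hdeg, smul_eq_mul, mul_comm]
      _ ≤ ∑ h ∈ univ.filter (fun h : ε × Bool => vtx p q h = v), (c h + 2 * d h) := by
          refine Finset.sum_le_sum fun h hh => ?_
          have hv : vtx p q h = v := by simpa using hh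
          have : 0 < d h := by
            apply Finset.card_pos.2
            by_cases hC : Sum.inl h ∈ C
            · exact ⟨j, by simp [hv, hC, hj]⟩
            · exact ⟨i, by simp [hv, hC, hi]⟩
          omega
      _ ≤ _ := Finset.sum_le_sum_of_subset (Finset.subset_univ _)
  · push Not at hsplit
    let D : Finset V := univ.filter fun v => Sum.inr (v, (⟨0, hm⟩ : Fin m)) ∈ C
    have hD : ∀ v i, (Sum.inr (v, i) ∈ C ↔ v ∈ D) := by
      intro v i
      simp only [D, mem_filter, mem_univ, true_and]
      exact ⟨hsplit _ _ _, hsplit _ _ _⟩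
    have hdv : ∀ h, d h = if (Sum.inl h ∈ C ↔ vtx p q h ∈ D) then 0 else m := by
      intro h
      simp only [d, hD]
      by_cases hh : (Sum.inl h ∈ C ↔ vtx p q h ∈ D) <;> simp [hh]
    rw [Fintype.sum_prod_type]
    simp only [Fintype.sum_bool, hdv, c, vtx, Bool.not_true, Bool.not_false, if_true,
      Bool.false_eq_true, if_false]
    by_cases hD2 : D.Nonempty ∧ D ≠ univ
    · have hl := hlam D hD2.1 hD2.2
      have hmin : r ≤ min k m * lam := by
        rcases le_total k m with h | h
        · rwa [min_eq_left h]
        · rwa [min_eq_right h]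
      calc 2 * r ≤ (univ.filter fun e => ¬ (p e ∈ D ↔ q e ∈ D)).card * (2 * min k m) := by
            nlinarith [Nat.mul_le_mul_left (min k m) hl]
        _ = ∑ e ∈ univ.filter (fun e => ¬ (p e ∈ D ↔ q e ∈ D)), 2 * min k m := by
            rw [Finset.sum_const, smul_eq_mul]
        _ ≤ ∑ e ∈ univ.filter (fun e => ¬ (p e ∈ D ↔ q e ∈ D)), _ := by
            refine Finset.sum_le_sum fun e he => ?_
            have he' : ¬ (p e ∈ D ↔ q e ∈ D) := by simpa using he
            have ha := min_le_left k m
            have hb := min_le_right k m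
            by_cases h1 : Sum.inl (e, true) ∈ C <;> by_cases h2 : Sum.inl (e, false) ∈ C <;>
            by_cases h3 : p e ∈ D <;> by_cases h4 : q e ∈ D <;>
            simp only [h1, h2, h3, h4, iff_true, iff_false, not_true, not_false_iff, true_iff,
              false_iff, if_true, if_false] at he' ⊢ <;> omega
        _ ≤ _ := Finset.sum_le_sum_of_subset (Finset.subset_univ _)
    · have hconst : (∀ v, v ∉ D) ∨ (∀ v, v ∈ D) := by
        by_cases h : D.Nonempty
        · right
          have : D = univ := by
            by_contra h'
            exact hD2 ⟨h, h'⟩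
          simp [this]
        · left
          rw [Finset.not_nonempty_iff_eq_empty] at h
          simp [h]
      have hex : ∃ e, ¬ (Sum.inl (e, true) ∈ C ↔ Sum.inl (e, false) ∈ C) := by
        by_contra hno
        push Not at hno
        apply Nat.not_even_iff_odd.2 hC
        have hcard : C.card = ∑ x, if x ∈ C then 1 else 0 := by simp
        rw [hcard, Fintype.sum_sum_type]
        apply Even.add
        · rw [Fintype.sum_prod_type]
          apply Finset.even_sum
          intro e _
          simp only [Fintype.sum_bool, hno e]
          exact Even.add_self _
        · rw [Fintype.sum_prod_type]
          simp only [hD]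
          rcases hconst with h | h
          · simp [h]
          · simp only [h, if_true]
            simp [hmV]
      obtain ⟨e, he⟩ := hex
      refine le_trans ?_ (Finset.single_le_sum (f := fun e => _) (fun _ _ => Nat.zero_le _)
        (Finset.mem_univ e))
      rcases hconst with h | h <;>
      by_cases h1 : Sum.inl (e, true) ∈ C <;> by_cases h2 : Sum.inl (e, false) ∈ C <;>
        simp only [h1, h2, h, iff_true, iff_false, not_true, not_false_iff, true_iff,
              false_iff, if_true, if_false] at he ⊢ <;> omega

/-- **Gallai's theorem** (Theorem 1(2) of the paper): let `r` be even, `k` odd and `lam ≥ 1`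
with `r/lam ≤ k ≤ (1 − 1/lam)·r`.  Then every `lam`-edge-connected `r`-regular multigraph `G`
with `k·|V(G)|` even has a `k`-factor. -/
theorem stmt_1 {V : Type} [Fintype V] [DecidableEq V] {ε : Type} [Fintype ε] [DecidableEq ε]
    (ends : ε → Sym2 V) (hloopless : ∀ e, ¬ (ends e).IsDiag)
    (r k lam : ℕ) (hr : Even r) (hk : Odd k) (hlam : 1 ≤ lam)
    (hlow : (r : ℝ) / lam ≤ k) (hhigh : (k : ℝ) ≤ (1 - 1 / lam) * r)
    (hconn : MEdgeConnected ends lam) (hreg : MRegular ends r)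
    (heven : Even (k * Fintype.card V)) :
    HasKFactor ends k := by
  have hlamR : (0 : ℝ) < lam := by exact_mod_cast hlam
  have hkpos : 0 < k := hk.pos
  have hlow' : r ≤ k * lam := by
    rw [div_le_iff₀ hlamR] at hlow
    exact_mod_cast hlow
  have hkr : (k : ℝ) * lam + r ≤ r * lam := by
    have h := mul_le_mul_of_nonneg_right hhigh hlamR.le
    have h2 : (1 - 1 / (lam : ℝ)) * r * lam = r * lam - r := by
      field_simp
    linarith
  have hkr' : k * lam + r ≤ r * lam := by exact_mod_cast hkr
  have hrpos : 0 < r := by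
    by_contra h
    have h0 : r = 0 := by omega
    have : 0 < k * lam := Nat.mul_pos hkpos hlam
    rw [h0] at hkr'
    omega
  have hklt : k < r := by
    by_contra h
    have := Nat.mul_le_mul_right lam (not_lt.1 h)
    omega
  obtain ⟨m, rfl⟩ := Nat.exists_eq_add_of_lt hklt
  obtain ⟨n, hn⟩ : ∃ n, n = m + 1 := ⟨_, rfl⟩
  have hrn : k + n = k + m + 1 := by omega
  have hml : k + m + 1 ≤ n * lam := by
    have : (k + m + 1) * lam = k * lam + n * lam := by rw [hn]; ring
    omega
  have hmV : Even (Fintype.card V) := by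
    rcases Nat.even_mul.1 heven with h | h
    · exact absurd h (Nat.not_even_iff_odd.2 hk)
    · exact h
  have hends : ∀ e, ∃ a b, ends e = s(a, b) := fun e => by
    induction h : ends e with
    | _ a b => exact ⟨a, b, rfl⟩
  choose p q hpq using hends
  have hne : ∀ e, p e ≠ q e := fun e h => hloopless e (by rw [hpq]; simpa using h)
  have hdeg : ∀ v, (univ.filter fun h : ε × Bool => vtx p q h = v).card = k + m + 1 := by
    intro v
    rw [← hreg v, mdeg, Finset.card_filter, Finset.card_filter, Fintype.sum_prod_type]
    refine Finset.sum_congr rfl fun e _ => ?_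
    have := hne e
    by_cases h1 : p e = v
    · have h2 : q e ≠ v := fun h => this (h1.trans h.symm)
      simp [vtx, hpq, h1, h2]
    · by_cases h2 : q e = v
      · simp [vtx, hpq, h1, h2]
      · simp [vtx, hpq, h1, h2, Ne.symm h1, Ne.symm h2]
  have hcutG : ∀ D : Finset V, D.Nonempty → D ≠ univ →
      lam ≤ (univ.filter fun e => ¬ (p e ∈ D ↔ q e ∈ D)).card := by
    intro D hD hD'
    by_contra hlt
    obtain ⟨u, hu⟩ := hD
    obtain ⟨v, hv⟩ : ∃ v, v ∉ D := by
      by_contra h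
      push Not at h
      exact hD' (Finset.eq_univ_iff_forall.2 h)
    have hw := hconn _ (by omega : (univ.filter fun e => ¬ (p e ∈ D ↔ q e ∈ D)).card ≤ lam - 1) u v
    apply hv
    clear hv
    induction hw with
    | refl => exact hu
    | tail _ hstep ih =>
      obtain ⟨e, he, hab⟩ := hstep
      have he' : p e ∈ D ↔ q e ∈ D := by simpa using he
      rw [hpq, Sym2.eq_iff] at hab
      rcases hab with ⟨h1, h2⟩ | ⟨h1, h2⟩
      · rw [← h2, ← he', h1]; exact ih
      · rw [← h1, he', h2]; exact ih
  obtain ⟨f, hff, hfw⟩ := tutte_weighted (gw p q k n) (gw_symm p q k n) (gw_self p q k n)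
    (k + m + 1) hrpos (gw_row p q k n _ hrn hdeg)
    (gw_cut p q k n _ lam hrn (by omega) hmV hlow' hml hdeg hcutG)
  have hinl : ∀ h h', f (Sum.inl h) = Sum.inl h' → h' = (h.1, !h.2) := by
    intro h h' hh
    have := hfw (Sum.inl h)
    rw [hh] at this
    by_contra hc
    simp [gw, hc] at this
  have hinr : ∀ v i, ∃ h, f (Sum.inr (v, i)) = Sum.inl h ∧ vtx p q h = v := by
    intro v i
    have := hfw (Sum.inr (v, i))
    rcases hh : f (Sum.inr (v, i)) with h | y
    · refine ⟨h, rfl, ?_⟩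
      rw [hh] at this
      by_contra hc
      simp [gw, hc] at this
    · rw [hh] at this
      simp [gw] at this
  choose g hg hgv using hinr
  refine ⟨univ.filter fun e => (f (Sum.inl (e, true))).isLeft, fun v => ?_⟩
  have hboth : ∀ e, (f (Sum.inl (e, true))).isLeft = (f (Sum.inl (e, false))).isLeft := by
    have hb : ∀ e b, (f (Sum.inl (e, b))).isLeft = true → (f (Sum.inl (e, !b))).isLeft = true := by
      intro e b h
      obtain ⟨h', hh⟩ := Sum.isLeft_iff.1 h
      have h2 := hinl _ _ hh
      have h3 := hff (Sum.inl (e, b))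
      rw [hh, h2] at h3
      simp only at h3
      rw [h3]; rfl
    intro e
    rw [Bool.eq_iff_iff]
    exact ⟨hb e true, hb e false⟩
  have e1 : mdegIn ends (univ.filter fun e => (f (Sum.inl (e, true))).isLeft) v
      = (univ.filter fun h : ε × Bool => vtx p q h = v ∧ (f (Sum.inl h)).isLeft).card := by
    rw [mdegIn, Finset.filter_filter, Finset.card_filter, Finset.card_filter,
      Fintype.sum_prod_type]
    refine Finset.sum_congr rfl fun e _ => ?_
    rw [Fintype.sum_bool, ← hboth]
    by_cases hL : (f (Sum.inl (e, true))).isLeft = true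
    · have := hne e
      by_cases h1 : p e = v
      · have h2 : q e ≠ v := fun h => this (h1.trans h.symm)
        simp [vtx, hpq, h1, h2, hL]
      · by_cases h2 : q e = v
        · simp [vtx, hpq, h1, h2, hL]
        · simp [vtx, hpq, h1, h2, hL, Ne.symm h1, Ne.symm h2]
    · simp [hL]
  have e2 : (univ.filter fun h : ε × Bool => vtx p q h = v ∧ ¬ (f (Sum.inl h)).isLeft).card
      = n := by
    have : (univ.filter fun h : ε × Bool => vtx p q h = v ∧ ¬ (f (Sum.inl h)).isLeft)
        = univ.image (g v) := by
      ext h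
      simp only [mem_filter, mem_univ, true_and, mem_image]
      constructor
      · rintro ⟨hv, hL⟩
        rcases hh : f (Sum.inl h) with h' | ⟨u, i⟩
        · rw [hh] at hL; simp at hL
        · have h3 := hff (Sum.inl h)
          rw [hh, hg] at h3
          have h4 : g u i = h := Sum.inl_injective h3
          have h5 := hgv u i
          rw [h4, hv] at h5
          subst h5
          exact ⟨i, h4⟩
      · rintro ⟨i, rfl⟩
        refine ⟨hgv v i, ?_⟩
        have h3 := hff (Sum.inr (v, i))
        rw [hg] at h3
        rw [h3]
        simp
    rw [this, Finset.card_image_of_injective, Finset.card_univ, Fintype.card_fin]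
    intro i j hij
    have h1 := hff (Sum.inr (v, i))
    have h2 := hff (Sum.inr (v, j))
    rw [hg] at h1 h2
    rw [hij, h2] at h1
    simpa using h1.symm
  have e3 := Finset.card_filter_add_card_filter_not
    (s := univ.filter fun h : ε × Bool => vtx p q h = v) (fun h => (f (Sum.inl h)).isLeft = true)
  rw [Finset.filter_filter, Finset.filter_filter, hdeg] at e3
  rw [e1]
  omega
end

section
/- Let r be an odd integer, k an even integer, and λ a positive integer, and let λ* be the odd integer with λ* ∈ {λ, λ+1}. If 2 ≤ k ≤ (1 − 1/λ*)·r, then every λ-edge-connected r-regular multigraph G has a k-factor. -/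
open Finset

/-! ### A weighted criterion for perfect matchings, from Tutte's theorem -/

theorem pm_of_weights {X : Type} [Fintype X] [DecidableEq X] (w : X → X → ℕ)
    (hs : ∀ x y, w x y = w y x) (h0 : ∀ x, w x x = 0) (N : ℕ) (hN : 0 < N)
    (hdeg : ∀ x, ∑ y, w x y = N)
    (hcut : ∀ C : Finset X, Odd C.card → N ≤ ∑ x ∈ C, ∑ y ∈ Cᶜ, w x y) :
    ∃ m : X → X, (∀ x, m (m x) = x) ∧ ∀ x, w x (m x) ≠ 0 := by
  classical
  let G : SimpleGraph X :=
    { Adj := fun x y => w x y ≠ 0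
      symm := by
        constructor
        intro x y h
        rw [hs]; exact h
      loopless := by
        constructor
        intro x h
        exact h (h0 x) }
  have key : ∀ u : Set X, ¬ G.IsTutteViolator u := by
    intro u hu
    unfold SimpleGraph.IsTutteViolator at hu
    set H := ((⊤ : G.Subgraph).deleteVerts u).coe with hH
    let K : H.ConnectedComponent → Finset X := fun c =>
      Finset.univ.filter fun x => ∃ h : x ∈ ((⊤ : G.Subgraph).deleteVerts u).verts,
        (⟨x, h⟩ : ((⊤ : G.Subgraph).deleteVerts u).verts) ∈ c.supp
    have hKcard : ∀ c, (K c).card = c.supp.ncard := by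
      intro c
      rw [← Set.ncard_image_of_injective c.supp Subtype.val_injective,
        ← Set.ncard_coe_finset]
      congr 1
      ext x
      simp [K]
    have hKdisj : ∀ c c' x, x ∈ K c → x ∈ K c' → c = c' := by
      intro c c' x hx hx'
      simp only [K, Finset.mem_filter, Finset.mem_univ, true_and,
        SimpleGraph.ConnectedComponent.mem_supp_iff] at hx hx'
      obtain ⟨h, hx⟩ := hx
      obtain ⟨h', hx'⟩ := hx'
      rw [← hx, ← hx']
    have hout : ∀ c x y, x ∈ K c → y ∉ K c → y ∉ u → w x y = 0 := by
      intro c x y hx hy hyu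
      by_contra hw
      simp only [K, Finset.mem_filter, Finset.mem_univ, true_and] at hx hy
      obtain ⟨h, hx⟩ := hx
      apply hy
      have hyv : y ∈ ((⊤ : G.Subgraph).deleteVerts u).verts := by simp [hyu]
      refine ⟨hyv, c.mem_supp_of_adj_mem_supp hx ?_⟩
      rw [hH, SimpleGraph.Subgraph.coe_adj, SimpleGraph.Subgraph.deleteVerts_adj]
      refine ⟨trivial, ?_, trivial, hyu, ?_⟩
      · simpa using h
      · exact hw
    let O : Finset H.ConnectedComponent := Finset.univ.filter fun c => Odd c.supp.ncard
    have hO : H.oddComponents.ncard = O.card := by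
      rw [← Set.ncard_coe_finset]
      congr 1
      ext c
      simp [O]
    let U : Finset X := Finset.univ.filter fun x => x ∈ u
    have hU : u.ncard = U.card := by
      rw [← Set.ncard_coe_finset]
      congr 1
      ext c
      simp [U]
    have h1 : O.card * N ≤ ∑ c ∈ O, ∑ x ∈ K c, ∑ y ∈ U, w x y := by
      rw [← smul_eq_mul, ← Finset.sum_const]
      apply Finset.sum_le_sum
      intro c hc
      have hodd : Odd (K c).card := by
        rw [hKcard]; simpa [O] using hc
      refine (hcut _ hodd).trans ?_
      apply Finset.sum_le_sum
      intro x hx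
      have : ∑ y ∈ (K c)ᶜ, w x y = ∑ y ∈ (K c)ᶜ.filter (· ∈ u), w x y := by
        rw [Finset.sum_filter]
        apply Finset.sum_congr rfl
        intro y hy
        split_ifs with hyu
        · rfl
        · exact hout c x y hx (by simpa using hy) hyu
      rw [this]
      apply Finset.sum_le_sum_of_subset
      intro y hy
      simp only [Finset.mem_filter] at hy
      simp [U, hy.2]
    have h2 : ∑ c ∈ O, ∑ x ∈ K c, ∑ y ∈ U, w x y ≤ U.card * N := by
      rw [← Finset.sum_biUnion]
      · rw [Finset.sum_comm, ← smul_eq_mul, ← Finset.sum_const]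
        apply Finset.sum_le_sum
        intro y _
        rw [← hdeg y]
        calc ∑ x ∈ O.biUnion K, w x y = ∑ x ∈ O.biUnion K, w y x := by
              apply Finset.sum_congr rfl; intro x _; exact hs x y
          _ ≤ _ := Finset.sum_le_sum_of_subset (Finset.subset_univ _)
      · intro c _ c' _ hne
        rw [Function.onFun, Finset.disjoint_left]
        intro x hx hx'
        exact hne (hKdisj c c' x hx hx')
    have h3 : O.card ≤ U.card := Nat.le_of_mul_le_mul_right (h1.trans h2) hN
    rw [hU, hO] at hu
    omega
  obtain ⟨M, hM⟩ := SimpleGraph.tutte.2 key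
  rw [SimpleGraph.Subgraph.isPerfectMatching_iff] at hM
  choose m hm hm' using hM
  refine ⟨m, fun x => ?_, fun x => ?_⟩
  · exact (hm' (m x) x (hm x).symm).symm
  · exact M.adj_sub (hm x)

/-! ### The gadget -/

section Gadget

set_option linter.unusedSectionVars false

variable {V ε : Type} [Fintype V] [DecidableEq V] [Fintype ε] [DecidableEq ε]

/-- Weights on the gadget graph: half-edges `ε × Bool` and `b` core vertices per vertex. -/
def gadgetW (vt : ε × Bool → V) (k b : ℕ) :
    (ε × Bool) ⊕ (V × Fin b) → (ε × Bool) ⊕ (V × Fin b) → ℕ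
  | Sum.inl h, Sum.inl h' => if h' = (h.1, !h.2) then k else 0
  | Sum.inl h, Sum.inr q => if vt h = q.1 then 1 else 0
  | Sum.inr q, Sum.inl h => if vt h = q.1 then 1 else 0
  | Sum.inr _, Sum.inr _ => 0

theorem gadgetW_symm (vt : ε × Bool → V) (k b : ℕ) (x y) :
    gadgetW vt k b x y = gadgetW vt k b y x := by
  rcases x with ⟨e, i⟩ | ⟨v, j⟩ <;> rcases y with ⟨e', i'⟩ | ⟨v', j'⟩ <;> simp only [gadgetW]
  have : ((e', i') = (e, !i)) ↔ ((e, i) = (e', !i')) := by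
    cases i <;> cases i' <;> simp [eq_comm]
  simp only [this]

theorem gadgetW_self (vt : ε × Bool → V) (k b : ℕ) (x) : gadgetW vt k b x x = 0 := by
  rcases x with ⟨e, i⟩ | ⟨v, j⟩ <;> simp [gadgetW]

theorem gadgetW_deg (vt : ε × Bool → V) (r k b : ℕ) (hbk : b + k = r)
    (hreg : ∀ v, (Finset.univ.filter fun h => vt h = v).card = r) (x) :
    ∑ y, gadgetW vt k b x y = r := by
  rcases x with h | ⟨v, j⟩
  · rw [Fintype.sum_sum_type]
    have h2 : ∑ q : V × Fin b, gadgetW vt k b (Sum.inl h) (Sum.inr q) = b := by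
      rw [Fintype.sum_prod_type, Finset.sum_eq_single (vt h)]
      · simp [gadgetW]
      · intro v _ hne
        simp [gadgetW, hne.symm]
      · simp
    rw [h2]
    simp only [gadgetW, Finset.sum_ite_eq', Finset.mem_univ, if_true]
    omega
  · rw [Fintype.sum_sum_type]
    simp [gadgetW, hreg]

theorem gadget_cut_mixed (vt : ε × Bool → V) (r k b : ℕ)
    (hreg : ∀ v, (Finset.univ.filter fun h => vt h = v).card = r)
    (C : Finset ((ε × Bool) ⊕ (V × Fin b))) (v : V) (j j' : Fin b)
    (hj : Sum.inr (v, j) ∈ C) (hj' : Sum.inr (v, j') ∉ C) :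
    r ≤ ∑ x ∈ C, ∑ y ∈ Cᶜ, gadgetW vt k b x y := by
  classical
  rw [← Finset.sum_product']
  let g : ε × Bool → ((ε × Bool) ⊕ (V × Fin b)) × ((ε × Bool) ⊕ (V × Fin b)) := fun h =>
    if Sum.inl h ∈ C then (Sum.inl h, Sum.inr (v, j')) else (Sum.inr (v, j), Sum.inl h)
  have ginj : Function.Injective g := by
    intro h h' hh
    by_cases h1 : (Sum.inl h) ∈ C <;> by_cases h2 : (Sum.inl h') ∈ C <;>
      simp [g, h1, h2] at hh <;> exact hh
  rw [← hreg v, Finset.card_eq_sum_ones]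
  calc ∑ h ∈ Finset.univ.filter (fun h => vt h = v), 1
      ≤ ∑ h ∈ Finset.univ.filter (fun h => vt h = v), gadgetW vt k b (g h).1 (g h).2 := by
        apply Finset.sum_le_sum
        intro h hh
        simp only [Finset.mem_filter, Finset.mem_univ, true_and] at hh
        by_cases h1 : (Sum.inl h) ∈ C <;> simp [g, h1, gadgetW, hh]
    _ = ∑ p ∈ (Finset.univ.filter (fun h => vt h = v)).image g, gadgetW vt k b p.1 p.2 := by
        rw [Finset.sum_image]
        intro a _ b _ hab
        exact ginj hab
    _ ≤ _ := by
        apply Finset.sum_le_sum_of_subset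
        intro p hp
        obtain ⟨h, -, rfl⟩ := Finset.mem_image.1 hp
        by_cases h1 : (Sum.inl h) ∈ C <;> simp [g, h1, hj, hj']

/-- The cost of an edge in a cut. -/
def ecost (k b : ℕ) (ct cf wt wf : Bool) : ℕ :=
  (if ct = cf then 0 else k) + (if ct = wt then 0 else b) + (if cf = wf then 0 else b)

theorem gadget_cut_sum (vt : ε × Bool → V) (k b : ℕ)
    (C : Finset ((ε × Bool) ⊕ (V × Fin b))) (W : Finset V)
    (hW : ∀ v j, Sum.inr (v, j) ∈ C ↔ v ∈ W) :
    ∑ x ∈ C, ∑ y ∈ Cᶜ, gadgetW vt k b x y =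
      ∑ e : ε, ecost k b (decide (Sum.inl (e, true) ∈ C)) (decide (Sum.inl (e, false) ∈ C))
        (decide (vt (e, true) ∈ W)) (decide (vt (e, false) ∈ W)) := by
  classical
  have h1 : ∑ x ∈ C, ∑ y ∈ Cᶜ, gadgetW vt k b x y =
      ∑ x, ∑ y, if x ∈ C ∧ y ∉ C then gadgetW vt k b x y else 0 := by
    rw [← Finset.sum_filter_add_sum_filter_not Finset.univ (fun x => x ∈ C)
      (fun x => ∑ y, if x ∈ C ∧ y ∉ C then gadgetW vt k b x y else 0)]
    have hz : ∑ x ∈ Finset.univ.filter (fun x => x ∉ C),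
        (∑ y, if x ∈ C ∧ y ∉ C then gadgetW vt k b x y else 0) = 0 := by
      apply Finset.sum_eq_zero
      intro x hx
      simp only [Finset.mem_filter, Finset.mem_univ, true_and] at hx
      simp [hx]
    rw [hz, add_zero]
    apply Finset.sum_congr
    · ext; simp
    · intro x hx
      replace hx : x ∈ C := by simpa using hx
      rw [← Finset.sum_filter]
      apply Finset.sum_congr
      · ext; simp [hx]
      · intros; rfl
  have hll : ∀ h : ε × Bool, (∑ h' : ε × Bool, if Sum.inl h ∈ C ∧ Sum.inl h' ∉ C then
      (if h' = (h.1, !h.2) then k else 0) else 0) =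
      if Sum.inl h ∈ C ∧ Sum.inl (h.1, !h.2) ∉ C then k else 0 := by
    intro h
    rw [Finset.sum_eq_single (h.1, !h.2)]
    · simp
    · intro h' _ hne
      simp [hne]
    · simp
  have hlr : ∀ h : ε × Bool, (∑ q : V × Fin b, if Sum.inl h ∈ C ∧ Sum.inr q ∉ C then
      (if vt h = q.1 then 1 else 0) else 0) =
      if Sum.inl h ∈ C ∧ vt h ∉ W then b else 0 := by
    intro h
    rw [Fintype.sum_prod_type, Finset.sum_eq_single (vt h)]
    · simp [hW]
    · intro v _ hne
      simp [hne.symm]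
    · simp
  have hrl : ∀ h : ε × Bool, (∑ q : V × Fin b, if Sum.inr q ∈ C ∧ Sum.inl h ∉ C then
      (if vt h = q.1 then 1 else 0) else 0) =
      if vt h ∈ W ∧ Sum.inl h ∉ C then b else 0 := by
    intro h
    rw [Fintype.sum_prod_type, Finset.sum_eq_single (vt h)]
    · simp [hW]
    · intro v _ hne
      simp [hne.symm]
    · simp
  rw [h1]
  simp only [Fintype.sum_sum_type, gadgetW]
  rw [Finset.sum_add_distrib]
  simp only [hll, hlr]
  simp only [ite_self, Finset.sum_const_zero, add_zero]
  rw [Finset.sum_comm (s := (Finset.univ : Finset (V × Fin b)))]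
  simp only [hrl]
  rw [← Finset.sum_add_distrib, ← Finset.sum_add_distrib, Fintype.sum_prod_type]
  apply Finset.sum_congr rfl
  intro e _
  rw [Fintype.sum_bool]
  simp only [Bool.not_true, Bool.not_false]
  by_cases a1 : (Sum.inl (e, true)) ∈ C <;> by_cases a2 : (Sum.inl (e, false)) ∈ C <;>
    by_cases a3 : vt (e, true) ∈ W <;> by_cases a4 : vt (e, false) ∈ W <;>
    simp [ecost, a1, a2, a3, a4] <;> omega

theorem gadget_parity (vt : ε × Bool → V) (r k b : ℕ) (hk : Even k) (hbk : b + k = r)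
    (hreg : ∀ v, (Finset.univ.filter fun h => vt h = v).card = r)
    (C : Finset ((ε × Bool) ⊕ (V × Fin b))) (W : Finset V)
    (hW : ∀ v j, Sum.inr (v, j) ∈ C ↔ v ∈ W) (hC : Odd C.card) :
    Odd (Finset.univ.filter fun e : ε =>
      ((decide (Sum.inl (e, true) ∈ C) = decide (vt (e, true) ∈ W)) ≠
      (decide (Sum.inl (e, false) ∈ C) = decide (vt (e, false) ∈ W)))).card := by
  classical
  rw [← ZMod.natCast_eq_one_iff_odd] at hC ⊢
  have hk' : (k : ZMod 2) = 0 := (ZMod.natCast_eq_zero_iff_even).2 hk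
  have hbr : (r : ZMod 2) = b := by rw [← hbk]; simp [hk']
  have e1 : (C.card : ZMod 2) = ∑ h : ε × Bool, (if Sum.inl h ∈ C then (1 : ZMod 2) else 0)
      + W.card * b := by
    have : C.card = ∑ x, if x ∈ C then 1 else 0 := by simp
    rw [this, Fintype.sum_sum_type]
    push_cast
    congr 1
    rw [Fintype.sum_prod_type]
    simp [hW]
  have e2 : ∑ h : ε × Bool, (if vt h ∈ W then (1 : ZMod 2) else 0) = W.card * b := by
    have : (∑ h : ε × Bool, if vt h ∈ W then 1 else 0) = W.card * r := by
      rw [← Finset.sum_filter, ← Finset.card_eq_sum_ones]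
      rw [Finset.card_eq_sum_card_fiberwise (f := vt) (t := W)]
      · rw [Finset.sum_const_nat]
        intro v hv
        rw [← hreg v]
        congr 1
        ext h
        simp only [Finset.mem_filter, Finset.mem_univ, true_and]
        constructor
        · rintro ⟨_, h⟩; exact h
        · rintro rfl; exact ⟨hv, rfl⟩
      · intro h hh
        simpa using hh
    have := congrArg (Nat.cast : ℕ → ZMod 2) this
    push_cast at this
    rw [this, hbr]
  rw [← hC, e1, ← e2, ← Finset.sum_add_distrib, Fintype.sum_prod_type, Finset.card_filter]
  push_cast
  apply Finset.sum_congr rfl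
  intro e _
  rw [Fintype.sum_bool]
  by_cases a1 : (Sum.inl (e, true)) ∈ C <;> by_cases a2 : (Sum.inl (e, false)) ∈ C <;>
    by_cases a3 : vt (e, true) ∈ W <;> by_cases a4 : vt (e, false) ∈ W <;>
    simp [a1, a2, a3, a4] <;> decide

theorem gadget_cut (vt : ε × Bool → V) (r k b lam lamS : ℕ) (hk : Even k) (hbk : b + k = r)
    (hb : 0 < b) (hlamS : Odd lamS) (hlamS' : lamS = lam ∨ lamS = lam + 1)
    (hbl : r ≤ b * lamS)
    (hreg : ∀ v, (Finset.univ.filter fun h => vt h = v).card = r)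
    (hconn : ∀ W : Finset V, (∃ e, decide (vt (e, true) ∈ W) ≠ decide (vt (e, false) ∈ W)) →
      lam ≤ (Finset.univ.filter fun e =>
        decide (vt (e, true) ∈ W) ≠ decide (vt (e, false) ∈ W)).card)
    (C : Finset ((ε × Bool) ⊕ (V × Fin b))) (hC : Odd C.card) :
    r ≤ ∑ x ∈ C, ∑ y ∈ Cᶜ, gadgetW vt k b x y := by
  classical
  by_cases hmix : ∃ v j j', Sum.inr (v, j) ∈ C ∧ Sum.inr (v, j') ∉ C
  · obtain ⟨v, j, j', hj, hj'⟩ := hmix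
    exact gadget_cut_mixed vt r k b hreg C v j j' hj hj'
  push Not at hmix
  let W : Finset V := Finset.univ.filter fun v => Sum.inr (v, (⟨0, hb⟩ : Fin b)) ∈ C
  have hW : ∀ v j, Sum.inr (v, j) ∈ C ↔ v ∈ W := by
    intro v j
    simp only [W, Finset.mem_filter, Finset.mem_univ, true_and]
    exact ⟨hmix v _ _, hmix v _ _⟩
  rw [gadget_cut_sum vt k b C W hW]
  have hT := gadget_parity vt r k b hk hbk hreg C W hW hC
  have hδ := hconn W
  set cost : ε → ℕ := fun e =>
    ecost k b (decide (Sum.inl (e, true) ∈ C)) (decide (Sum.inl (e, false) ∈ C))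
        (decide (vt (e, true) ∈ W)) (decide (vt (e, false) ∈ W)) with hcost
  by_contra hlt
  push Not at hlt
  change ∑ e, cost e < r at hlt
  have hsingle : ∀ e, cost e < r := fun e =>
    lt_of_le_of_lt (Finset.single_le_sum (f := cost) (fun _ _ => Nat.zero_le _)
      (Finset.mem_univ e)) hlt
  set T := Finset.univ.filter fun e : ε =>
      ((decide (Sum.inl (e, true) ∈ C) = decide (vt (e, true) ∈ W)) ≠
      (decide (Sum.inl (e, false) ∈ C) = decide (vt (e, false) ∈ W))) with hTdef
  set D := Finset.univ.filter fun e =>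
        decide (vt (e, true) ∈ W) ≠ decide (vt (e, false) ∈ W) with hDdef
  have f1 : ∀ e ∈ T, e ∈ D ∧ b ≤ cost e := by
    intro e he
    have hs := hsingle e
    simp only [hTdef, hDdef, hcost, Finset.mem_filter, Finset.mem_univ, true_and] at he hs ⊢
    generalize decide (Sum.inl (e, true) ∈ C) = c1 at *
    generalize decide (Sum.inl (e, false) ∈ C) = c2 at *
    generalize decide (vt (e, true) ∈ W) = c3 at *
    generalize decide (vt (e, false) ∈ W) = c4 at *
    cases c1 <;> cases c2 <;> cases c3 <;> cases c4 <;> simp [ecost] at he hs ⊢ <;> omega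
  have f2 : ∀ e ∈ D, e ∉ T → k ≤ cost e := by
    intro e he he'
    have hs := hsingle e
    simp only [hTdef, hDdef, hcost, Finset.mem_filter, Finset.mem_univ, true_and] at he he' hs ⊢
    generalize decide (Sum.inl (e, true) ∈ C) = c1 at *
    generalize decide (Sum.inl (e, false) ∈ C) = c2 at *
    generalize decide (vt (e, true) ∈ W) = c3 at *
    generalize decide (vt (e, false) ∈ W) = c4 at *
    cases c1 <;> cases c2 <;> cases c3 <;> cases c4 <;> simp [ecost] at he he' hs ⊢ <;> omega
  obtain ⟨e0, he0⟩ : T.Nonempty := by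
    rw [← Finset.card_pos]; exact hT.pos
  have he0D := (f1 e0 he0).1
  have hD : lam ≤ D.card := hδ ⟨e0, by simpa [hDdef] using he0D⟩
  by_cases hs : ∃ s ∈ D, s ∉ T
  · obtain ⟨s, hsD, hsT⟩ := hs
    have hne : s ≠ e0 := by rintro rfl; exact hsT he0
    have h1 : ∑ e ∈ ({s, e0} : Finset ε), cost e ≤ ∑ e, cost e :=
      Finset.sum_le_sum_of_subset (Finset.subset_univ _)
    rw [Finset.sum_pair hne] at h1
    have := f2 s hsD hsT
    have := (f1 e0 he0).2
    omega
  · push Not at hs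
    have h1 : D.card ≤ T.card := Finset.card_le_card hs
    have h2 : lamS ≤ T.card := by
      obtain ⟨a, ha⟩ := hT
      obtain ⟨c, hc⟩ := hlamS
      omega
    have h3 : T.card * b ≤ ∑ e ∈ T, cost e := by
      rw [← smul_eq_mul, ← Finset.sum_const]
      exact Finset.sum_le_sum fun e he => (f1 e he).2
    have h4 : ∑ e ∈ T, cost e ≤ ∑ e, cost e :=
      Finset.sum_le_sum_of_subset (Finset.subset_univ _)
    have h5 : lamS * b ≤ T.card * b := Nat.mul_le_mul_right _ h2
    rw [mul_comm] at hbl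
    omega

end Gadget

/-- Theorem 1(3) of the paper: let `r` be odd, `k` even, `lam ≥ 1`, and let `lamS` be the odd
integer in `{lam, lam + 1}`.  If `2 ≤ k ≤ (1 − 1/lamS)·r`, then every `lam`-edge-connected
`r`-regular multigraph has a `k`-factor. -/
theorem stmt_2 {V : Type} [Fintype V] [DecidableEq V] {ε : Type} [Fintype ε] [DecidableEq ε]
    (ends : ε → Sym2 V) (hloopless : ∀ e, ¬ (ends e).IsDiag)
    (r k lam lamS : ℕ) (hr : Odd r) (hk : Even k) (hlam : 1 ≤ lam)
    (hlamS : Odd lamS) (hlamS' : lamS = lam ∨ lamS = lam + 1)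
    (hk2 : 2 ≤ k) (hhigh : (k : ℝ) ≤ (1 - 1 / lamS) * r)
    (hconn : MEdgeConnected ends lam) (hreg : MRegular ends r) :
    HasKFactor ends k := by
  classical
  have hr0 : 0 < r := hr.pos
  have hl0 : 0 < lamS := hlamS.pos
  have hmul : k * lamS + r ≤ lamS * r := by
    have h1 : (0 : ℝ) < lamS := by exact_mod_cast hl0
    have h2 : (k : ℝ) * lamS ≤ ((1 - 1 / lamS) * r) * lamS :=
      mul_le_mul_of_nonneg_right hhigh h1.le
    have h3 : ((1 - 1 / (lamS : ℝ)) * r) * lamS = lamS * r - r := by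
      field_simp
    rw [h3] at h2
    have : (k : ℝ) * lamS + r ≤ lamS * r := by linarith
    exact_mod_cast this
  have hkr : k < r := by
    by_contra h
    push Not at h
    have := Nat.mul_le_mul_right lamS h
    rw [mul_comm r] at this
    omega
  obtain ⟨b, hb⟩ : ∃ b, b + k = r := ⟨r - k, by omega⟩
  have hb0 : 0 < b := by omega
  have hbl : r ≤ b * lamS := by
    rw [← hb] at hmul ⊢
    nlinarith
  have hends : ∀ e, ∃ p : V × V, ends e = s(p.1, p.2) := by
    intro e
    induction h : ends e with
    | _ x y => exact ⟨(x, y), rfl⟩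
  choose p hp using hends
  have hpne : ∀ e, (p e).1 ≠ (p e).2 := by
    intro e h
    apply hloopless e
    rw [hp e]
    simpa using h
  let vt : ε × Bool → V := fun h => if h.2 then (p h.1).1 else (p h.1).2
  have vt_mem : ∀ e v, v ∈ ends e ↔ ∃ i, vt (e, i) = v := by
    intro e v
    rw [hp e]
    simp only [Sym2.mem_iff, Bool.exists_bool, vt]
    simp only [if_true, Bool.false_eq_true, if_false]
    constructor
    · rintro (h | h)
      · exact Or.inr h.symm
      · exact Or.inl h.symm
    · rintro (h | h)
      · exact Or.inr h.symm
      · exact Or.inl h.symm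
  have vt_inj : ∀ e i i', vt (e, i) = vt (e, i') → i = i' := by
    intro e i i' h
    have h1 := hpne e
    cases i <;> cases i' <;> simp [vt] at h ⊢
    · exact h1 h.symm
    · exact h1 h
  have hreg' : ∀ v, (Finset.univ.filter fun h => vt h = v).card = r := by
    intro v
    rw [← hreg v, mdeg]
    rw [← Finset.card_image_of_injOn (f := Prod.fst)
      (s := Finset.univ.filter fun h => vt h = v)]
    · congr 1
      ext e
      simp [vt_mem]
    · rintro ⟨e, i⟩ hh ⟨e', i'⟩ hh' heq
      simp only [Finset.coe_filter, Finset.mem_univ, true_and, Set.mem_ofPred_eq] at hh hh' heq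
      subst heq
      rw [vt_inj e i i' (hh.trans hh'.symm)]
  have hconn' : ∀ W : Finset V,
      (∃ e, decide (vt (e, true) ∈ W) ≠ decide (vt (e, false) ∈ W)) →
      lam ≤ (Finset.univ.filter fun e =>
        decide (vt (e, true) ∈ W) ≠ decide (vt (e, false) ∈ W)).card := by
    rintro W ⟨e0, he0⟩
    by_contra hlt
    push Not at hlt
    have hc := hconn (Finset.univ.filter fun e =>
        decide (vt (e, true) ∈ W) ≠ decide (vt (e, false) ∈ W)) (by omega)
    have hside : ∀ u v : V, (u ∈ W ↔ v ∈ W) := by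
      intro u v
      have := hc u v
      induction this with
      | refl => rfl
      | tail _ hstep ih =>
        rename_i x y _
        refine ih.trans ?_
        obtain ⟨e, he, hxy⟩ := hstep
        simp only [Finset.mem_sdiff, Finset.mem_univ, Finset.mem_filter, true_and, ne_eq,
          not_not, decide_eq_decide] at he
        have hx : x ∈ ends e := by rw [hxy]; simp
        have hy : y ∈ ends e := by rw [hxy]; simp
        obtain ⟨i, rfl⟩ := (vt_mem e x).1 hx
        obtain ⟨j, rfl⟩ := (vt_mem e y).1 hy
        cases i <;> cases j <;> simp [he]
    apply he0
    simp only [decide_eq_decide]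
    exact hside _ _
  obtain ⟨m, hmm, hmw⟩ := pm_of_weights (gadgetW vt k b) (gadgetW_symm vt k b)
    (gadgetW_self vt k b) r hr0 (gadgetW_deg vt r k b hb hreg')
    (gadget_cut vt r k b lam lamS hk hb hb0 hlamS hlamS' hbl hreg' hconn')
  have minj : Function.Injective m := fun x y h => by rw [← hmm x, h, hmm y]
  have hl : ∀ h, m (Sum.inl h) = Sum.inl (h.1, !h.2) ∨
      ∃ j, m (Sum.inl h) = Sum.inr (vt h, j) := by
    intro h
    have := hmw (Sum.inl h)
    rcases hx : m (Sum.inl h) with h' | ⟨v, j⟩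
    · rw [hx] at this
      simp only [gadgetW, ne_eq, ite_eq_right_iff, Classical.not_imp] at this
      exact Or.inl (by rw [this.1])
    · rw [hx] at this
      simp only [gadgetW, ne_eq, ite_eq_right_iff, Classical.not_imp] at this
      exact Or.inr ⟨j, by rw [this.1]⟩
  have hrr : ∀ v j, ∃ h, vt h = v ∧ m (Sum.inr (v, j)) = Sum.inl h := by
    intro v j
    have := hmw (Sum.inr (v, j))
    rcases hx : m (Sum.inr (v, j)) with h' | q
    · rw [hx] at this
      simp only [gadgetW, ne_eq, ite_eq_right_iff, Classical.not_imp] at this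
      exact ⟨h', this.1, rfl⟩
    · rw [hx] at this
      simp [gadgetW] at this
  refine ⟨Finset.univ.filter fun e => m (Sum.inl (e, true)) = Sum.inl (e, false), fun v => ?_⟩
  have hF : ∀ e i, m (Sum.inl (e, true)) = Sum.inl (e, false) ↔
      m (Sum.inl (e, i)) = Sum.inl (e, !i) := by
    intro e i
    cases i
    · constructor
      · intro h
        rw [← h, hmm]; rfl
      · intro h
        simp only [Bool.not_false] at h
        rw [← h, hmm]
    · rfl
  have hsplit := Finset.card_filter_add_card_filter_not
    (s := Finset.univ.filter fun h => vt h = v)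
    (fun h => m (Sum.inl h) = Sum.inl (h.1, !h.2))
  rw [hreg' v] at hsplit
  have c1 : mdegIn ends (Finset.univ.filter fun e => m (Sum.inl (e, true)) = Sum.inl (e, false)) v
      = ((Finset.univ.filter fun h => vt h = v).filter
        fun h => m (Sum.inl h) = Sum.inl (h.1, !h.2)).card := by
    rw [mdegIn, ← Finset.card_image_of_injOn (f := Prod.fst)
      (s := (Finset.univ.filter fun h => vt h = v).filter
        fun h => m (Sum.inl h) = Sum.inl (h.1, !h.2))]
    · congr 1
      ext e
      simp only [Finset.mem_filter, Finset.mem_univ, true_and, Finset.mem_image, Prod.exists,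
        vt_mem]
      constructor
      · rintro ⟨h1, i, hi⟩
        exact ⟨e, i, ⟨hi, (hF e i).1 h1⟩, rfl⟩
      · rintro ⟨e', i, ⟨hi, h1⟩, rfl⟩
        exact ⟨(hF e' i).2 h1, i, hi⟩
    · rintro ⟨e, i⟩ hh ⟨e', i'⟩ hh' heq
      simp only [Finset.coe_filter, Finset.mem_filter, Finset.mem_univ, true_and,
        Set.mem_ofPred_eq] at hh hh' heq
      subst heq
      rw [vt_inj e i i' (hh.1.trans hh'.1.symm)]
  choose g hg1 hg2 using hrr v
  have c2 : ((Finset.univ.filter fun h => vt h = v).filter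
        fun h => ¬ m (Sum.inl h) = Sum.inl (h.1, !h.2)).card = b := by
    have ginj : Function.Injective g := by
      intro j j' h
      have : m (Sum.inr (v, j)) = m (Sum.inr (v, j')) := by rw [hg2, hg2, h]
      simpa using minj this
    have := Finset.card_image_of_injective Finset.univ ginj
    rw [Finset.card_univ, Fintype.card_fin] at this
    refine Eq.trans ?_ this
    congr 1
    ext h
    simp only [Finset.mem_filter, Finset.mem_univ, true_and, Finset.mem_image]
    constructor
    · rintro ⟨h1, h2⟩
      rcases hl h with h3 | ⟨j, h3⟩
      · exact absurd h3 h2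
      · refine ⟨j, ?_⟩
        rw [h1] at h3
        have h4 := hg2 j
        rw [← h3, hmm] at h4
        simpa using h4.symm
    · rintro ⟨j, rfl⟩
      refine ⟨hg1 j, ?_⟩
      rw [← hg2 j, hmm]
      simp
  rw [c1]
  omega
end

section
/- Let G be a finite multigraph and let g and f be integer-valued functions on V(G) satisfying g(v) ≤ f(v) and g(v) ≡ f(v) (mod 2) for all v ∈ V(G). Then G has a parity (g, f)-factor if and only if for every pair of disjoint subsets S and T of V(G), η(S, T) := f(S) + deg_G(T) − g(T) − e_G(S, T) − q(S, T) ≥ 0, where q(S, T) denotes the number of components D of G − (S ∪ T) satisfying f(D) + e_G(D, T) ≡ 1 (mod 2). -/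
open Finset

open scoped Classical in
/-- The set of colours whose colour class outside `U` has odd size. -/
noncomputable def oddCols {X ι : Type} [Fintype X] [Fintype ι] (U : Finset X) (κ : X → ι) :
    Finset ι :=
  Finset.univ.filter fun k => Odd (Finset.univ.filter fun y => y ∉ U ∧ κ y = k).card

open scoped Classical in
theorem exists_cert_of_no_pm {X : Type} [Fintype X] (G : SimpleGraph X)
    (h : ¬ ∃ M : G.Subgraph, M.IsPerfectMatching) :
    ∃ (ι : Type) (_ : Fintype ι) (_ : Nonempty ι) (U : Finset X) (κ : X → ι),
      (∀ x y, G.Adj x y → x ∉ U → y ∉ U → κ x = κ y) ∧ U.card < (oddCols U κ).card := by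
  rw [SimpleGraph.tutte] at h
  push Not at h
  obtain ⟨u, hu⟩ := h
  unfold SimpleGraph.IsTutteViolator at hu
  set G' := ((⊤ : G.Subgraph).deleteVerts u) with hG'
  have hv : ∀ y, y ∈ G'.verts ↔ y ∉ u := by intro y; simp [hG']
  refine ⟨Option G'.coe.ConnectedComponent, Fintype.ofFinite _, ⟨none⟩, u.toFinset,
    fun y => if hy : y ∈ G'.verts then some (G'.coe.connectedComponentMk ⟨y, hy⟩) else none,
    ?_, ?_⟩
  · intro x y hxy hx hy
    have hx' : x ∈ G'.verts := by rw [hv]; simpa using hx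
    have hy' : y ∈ G'.verts := by rw [hv]; simpa using hy
    simp only [hx', hy', dif_pos]
    congr 1
    apply SimpleGraph.ConnectedComponent.sound
    apply SimpleGraph.Adj.reachable
    rw [SimpleGraph.Subgraph.coe_adj]
    change G'.Adj x y
    rw [hG', SimpleGraph.Subgraph.deleteVerts_adj]
    refine ⟨trivial, ?_, trivial, ?_, hxy⟩
    · simpa using hx
    · simpa using hy
  · rw [← Set.ncard_eq_toFinset_card']
    refine lt_of_lt_of_le hu ?_
    rw [← Set.ncard_coe_finset]
    refine Set.ncard_le_ncard_of_injOn some ?_ (by intro a _ b _ hab; simpa using hab)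
      (Set.toFinite _)
    intro c hc
    simp only [oddCols, Finset.coe_filter, Finset.mem_univ, true_and, Set.mem_ofPred_eq]
    have hc' : Odd c.supp.ncard := hc
    convert hc' using 1
    rw [← Set.ncard_image_of_injective c.supp Subtype.val_injective, ← Set.ncard_coe_finset]
    congr 1
    ext y
    simp only [Finset.coe_filter, Finset.mem_univ, true_and, Set.mem_ofPred_eq, Set.mem_image,
      SimpleGraph.ConnectedComponent.mem_supp_iff, Subtype.exists, exists_and_right,
      exists_eq_right, Set.mem_toFinset]
    constructor
    · rintro ⟨h1, h2⟩
      have hy' : y ∈ G'.verts := by rw [hv]; exact h1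
      rw [dif_pos hy'] at h2
      exact ⟨hy', by simpa using h2⟩
    · rintro ⟨hy', h2⟩
      refine ⟨(hv y).1 hy', ?_⟩
      rw [dif_pos hy', h2]

open scoped Classical in
theorem oddCols_step {X ι : Type} [Fintype X] [Fintype ι] (U : Finset X) (κ : X → ι)
    (x : X) (hx : x ∈ U) (a b : ι) :
    (oddCols U κ).card ≤
      (oddCols (U.erase x) (fun y => if y = x then a else if κ y = b then a else κ y)).card + 1 := by
  set κ' : X → ι := fun y => if y = x then a else if κ y = b then a else κ y with hκ'
  have hother : ∀ k, k ≠ a → k ≠ b → (k ∈ oddCols U κ ↔ k ∈ oddCols (U.erase x) κ') := by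
    intro k hka hkb
    simp only [oddCols, Finset.mem_filter, Finset.mem_univ, true_and]
    have : (Finset.univ.filter fun y => y ∉ U ∧ κ y = k) =
        (Finset.univ.filter fun y => y ∉ U.erase x ∧ κ' y = k) := by
      ext y
      simp only [hκ', Finset.mem_filter, Finset.mem_univ, true_and, Finset.mem_erase]
      grind
    rw [this]
  by_cases hab : a ∈ oddCols U κ ∧ b ∈ oddCols U κ ∧ a ≠ b
  · obtain ⟨ha, hb, hne⟩ := hab
    have hmem : a ∈ oddCols (U.erase x) κ' := by
      simp only [oddCols, Finset.mem_filter, Finset.mem_univ, true_and] at ha hb ⊢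
      have : (Finset.univ.filter fun y => y ∉ U.erase x ∧ κ' y = a) =
        insert x ((Finset.univ.filter fun y => y ∉ U ∧ κ y = a) ∪
          (Finset.univ.filter fun y => y ∉ U ∧ κ y = b)) := by
        ext y
        simp only [hκ', Finset.mem_filter, Finset.mem_univ, true_and, Finset.mem_erase,
          Finset.mem_insert, Finset.mem_union]
        grind
      rw [this, Finset.card_insert_of_notMem (by simp [hx]), Finset.card_union_of_disjoint]
      · grind
      · rw [Finset.disjoint_left]; intro y; simp; grind
    have hsub : (oddCols U κ) ⊆ insert b (oddCols (U.erase x) κ') := by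
      intro k hk
      rw [Finset.mem_insert]
      by_cases h1 : k = b
      · exact Or.inl h1
      by_cases h2 : k = a
      · right; rw [h2]; exact hmem
      · right; exact (hother k h2 h1).1 hk
    exact (Finset.card_le_card hsub).trans (Finset.card_insert_le _ _)
  · have : ∃ d, ∀ k ∈ oddCols U κ, k = a ∨ k = b → k = d := by
      by_cases ha : a ∈ oddCols U κ
      · exact ⟨a, by grind⟩
      · exact ⟨b, by grind⟩
    obtain ⟨d, hd⟩ := this
    have hsub : (oddCols U κ) ⊆ insert d (oddCols (U.erase x) κ') := by
      intro k hk
      rw [Finset.mem_insert]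
      by_cases h1 : k = a ∨ k = b
      · exact Or.inl (hd k hk h1)
      · push Not at h1
        right; exact (hother k h1.1 h1.2).1 hk
    exact (Finset.card_le_card hsub).trans (Finset.card_insert_le _ _)

open scoped Classical in
theorem exists_min_cert {X : Type} [Fintype X] (G : SimpleGraph X)
    (h : ¬ ∃ M : G.Subgraph, M.IsPerfectMatching) :
    ∃ (ι : Type) (_ : Fintype ι) (U : Finset X) (κ : X → ι),
      (∀ x y, G.Adj x y → x ∉ U → y ∉ U → κ x = κ y) ∧ U.card < (oddCols U κ).card ∧
      ∀ x ∈ U, ∀ a b, ∃ y, G.Adj x y ∧ y ∉ U ∧ κ y ≠ a ∧ κ y ≠ b := by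
  obtain ⟨ι, i1, i2, U, κ, h1, h2⟩ := exists_cert_of_no_pm G h
  refine ⟨ι, i1, ?_⟩
  induction hn : U.card using Nat.strong_induction_on generalizing U κ with
  | _ n ih =>
  subst hn
  by_cases hc : ∀ x ∈ U, ∀ a b, ∃ y, G.Adj x y ∧ y ∉ U ∧ κ y ≠ a ∧ κ y ≠ b
  · exact ⟨U, κ, h1, h2, hc⟩
  push Not at hc
  obtain ⟨x, hx, a, b, hab⟩ := hc
  have hcard : (U.erase x).card + 1 = U.card := Finset.card_erase_add_one hx
  refine ih _ ?_ (U.erase x) (fun y => if y = x then a else if κ y = b then a else κ y) ?_ ?_ rfl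
  · omega
  · intro y z hyz hy hz
    have e1 := h1 y z hyz
    have e2 := hab y
    have e3 := hab z
    have hyz' := hyz.symm
    have hne := hyz.ne
    simp only [Finset.mem_erase, not_and] at hy hz
    by_cases q1 : y = x
    · subst q1
      have q2 : z ≠ y := hne.symm
      have := e3 hyz (hz q2)
      simp only [if_true, if_neg q2]
      grind
    · by_cases q2 : z = x
      · subst q2
        have := e2 hyz' (hy q1)
        simp only [if_true, if_neg q1]
        grind
      · simp only [if_neg q1, if_neg q2, e1 (hy q1) (hz q2)]
  · have := oddCols_step U κ x hx a b
    omega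

/-- The vertex-gadget graph of a graph with half-edge set `H`, involution `σ`,
incidence map `π` and core sizes `c`. -/
def gadget {H V : Type} (σ : H → H) (hσ : ∀ h, σ (σ h) = h) (hσ' : ∀ h, σ h ≠ h)
    (π : H → V) (c : V → ℕ) : SimpleGraph (H ⊕ (Σ v : V, Fin (c v))) where
  Adj a b := match a, b with
    | Sum.inl h, Sum.inl h' => h' = σ h
    | Sum.inl h, Sum.inr p => π h = p.1
    | Sum.inr p, Sum.inl h => π h = p.1
    | Sum.inr _, Sum.inr _ => False
  symm := by
    constructor
    rintro (a | a) (b | b) hab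
    · change b = σ a at hab
      change a = σ b
      rw [hab, hσ]
    · exact hab
    · exact hab
    · exact hab
  loopless := by
    constructor
    rintro (a | a) hab
    · exact hσ' a (Eq.symm hab)
    · exact hab

open scoped Classical in
theorem factor_of_pm {H V : Type} [Fintype H] [Fintype V]
    (σ : H → H) (hσ : ∀ h, σ (σ h) = h) (hσ' : ∀ h, σ h ≠ h)
    (π : H → V) (c : V → ℕ)
    (hM : ∃ M : (gadget σ hσ hσ' π c).Subgraph, M.IsPerfectMatching) :
    ∃ F : Finset H, (∀ h, h ∈ F ↔ σ h ∈ F) ∧ ∀ v,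
      (Finset.univ.filter fun h => h ∈ F ∧ π h = v).card + c v =
        (Finset.univ.filter fun h => π h = v).card := by
  obtain ⟨M, hM⟩ := hM
  rw [SimpleGraph.Subgraph.isPerfectMatching_iff] at hM
  choose m hm hm' using hM
  have hinv : ∀ x, m (m x) = x := fun x => (hm' _ _ (hm x).symm).symm
  have hadj : ∀ x, (gadget σ hσ hσ' π c).Adj x (m x) := fun x => (hm x).adj_sub
  have hl : ∀ h, m (Sum.inl h) = Sum.inl (σ h) ∨ ∃ i, m (Sum.inl h) = Sum.inr ⟨π h, i⟩ := by
    intro h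
    have := hadj (Sum.inl h)
    rcases hmm : m (Sum.inl h) with h' | ⟨v, i⟩
    · rw [hmm] at this
      left; rw [show h' = σ h from this]
    · rw [hmm] at this
      obtain rfl : π h = v := this
      right; exact ⟨i, rfl⟩
  have hr : ∀ v i, ∃ h, m (Sum.inr ⟨v, i⟩) = Sum.inl h ∧ π h = v := by
    intro v i
    have := hadj (Sum.inr ⟨v, i⟩)
    rcases hmm : m (Sum.inr ⟨v, i⟩) with h' | p
    · rw [hmm] at this
      exact ⟨h', rfl, this⟩
    · rw [hmm] at this
      exact absurd this (fun h => h)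
  refine ⟨Finset.univ.filter fun h => m (Sum.inl h) = Sum.inl (σ h), ?_, ?_⟩
  · intro h
    simp only [Finset.mem_filter, Finset.mem_univ, true_and, hσ]
    constructor
    · intro h1; rw [← h1, hinv]
    · intro h1; rw [← h1, hinv]
  · intro v
    have key : (Finset.univ.filter fun h => m (Sum.inl h) ≠ Sum.inl (σ h) ∧ π h = v).card
        = c v := by
      rw [← Fintype.card_fin (c v), ← Finset.card_univ]
      symm
      choose p hp hp' using hr v
      refine Finset.card_bij (fun i _ => p i) ?_ ?_ ?_
      · intro i _
        simp only [Finset.mem_filter, Finset.mem_univ, true_and]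
        refine ⟨?_, hp' i⟩
        rw [← hp i, hinv]
        simp
      · intro i _ j _ hij
        have : m (Sum.inr ⟨v, i⟩) = m (Sum.inr ⟨v, j⟩) := by rw [hp, hp, hij]
        have := congrArg m this
        rw [hinv, hinv] at this
        simpa using this
      · intro h hh
        simp only [Finset.mem_filter, Finset.mem_univ, true_and] at hh
        obtain ⟨h1, rfl⟩ := hh
        obtain ⟨i, hi⟩ := (hl h).resolve_left h1
        refine ⟨i, Finset.mem_univ _, ?_⟩
        have := congrArg m hi
        rw [hinv, hp] at this
        exact (Sum.inl_injective this).symm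
    rw [← key, ← Finset.card_union_of_disjoint]
    · congr 1
      ext h
      simp only [Finset.mem_filter, Finset.mem_univ, true_and, Finset.mem_union]
      tauto
    · rw [Finset.disjoint_left]; intro h; simp; tauto

theorem even_card_of_invol {H : Type} (A : Finset H) (σ : H → H)
    (hσ : ∀ h, σ (σ h) = h) (hσ' : ∀ h, σ h ≠ h) (hA : ∀ h ∈ A, σ h ∈ A) : Even A.card := by
  have : ∑ _h ∈ A, (1 : ZMod 2) = 0 := by
    refine Finset.sum_involution (fun h _ => σ h) ?_ ?_ ?_ ?_
    · intro a _; decide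
    · intro a _ _; exact hσ' a
    · intro a ha; exact hA a ha
    · intro a _; exact hσ a
  rw [Finset.sum_const, nsmul_eq_mul, mul_one] at this
  exact (ZMod.natCast_eq_zero_iff_even).1 this

section comps
variable {V : Type} [Fintype V] [DecidableEq V] {ε : Type} [Fintype ε]

theorem MReachIn.symm' {ends : ε → Sym2 V} {A : Finset V} {u v : V}
    (h : MReachIn ends A u v) : MReachIn ends A v u := by
  induction h with
  | refl => exact Relation.ReflTransGen.refl
  | tail _ hbc ih =>
    obtain ⟨h1, h2, e, he⟩ := hbc
    exact Relation.ReflTransGen.head ⟨h2, h1, e, by rw [he, Sym2.eq_swap]⟩ ih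

open scoped Classical in
/-- The component of `v` in the graph induced on `A`. -/
noncomputable def compOf (ends : ε → Sym2 V) (A : Finset V) (v : V) : Finset V :=
  A.filter (MReachIn ends A v)

theorem mem_compOf {ends : ε → Sym2 V} {A : Finset V} {v w : V} :
    w ∈ compOf ends A v ↔ w ∈ A ∧ MReachIn ends A v w := by
  simp [compOf]

theorem compOf_eq {ends : ε → Sym2 V} {A : Finset V} {v w : V}
    (h : MReachIn ends A v w) : compOf ends A v = compOf ends A w := by
  ext x
  rw [mem_compOf, mem_compOf]
  constructor
  · rintro ⟨h1, h2⟩; exact ⟨h1, Relation.ReflTransGen.trans h.symm' h2⟩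
  · rintro ⟨h1, h2⟩; exact ⟨h1, Relation.ReflTransGen.trans h h2⟩

theorem self_mem_compOf {ends : ε → Sym2 V} {A : Finset V} {v : V} (h : v ∈ A) :
    v ∈ compOf ends A v := mem_compOf.2 ⟨h, Relation.ReflTransGen.refl⟩

theorem isComp_compOf {ends : ε → Sym2 V} {A : Finset V} {v : V} (h : v ∈ A) :
    MIsComp ends A (compOf ends A v) := ⟨v, h, rfl⟩

theorem isComp_iff {ends : ε → Sym2 V} {A D : Finset V} :
    MIsComp ends A D ↔ ∃ v ∈ A, D = compOf ends A v := Iff.rfl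

theorem isComp_eq {ends : ε → Sym2 V} {A D : Finset V} (hD : MIsComp ends A D) {v : V}
    (hv : v ∈ D) : D = compOf ends A v := by
  obtain ⟨w, _, rfl⟩ := isComp_iff.1 hD
  exact compOf_eq (mem_compOf.1 hv).2

theorem isComp_subset {ends : ε → Sym2 V} {A D : Finset V} (hD : MIsComp ends A D) : D ⊆ A := by
  obtain ⟨w, _, rfl⟩ := isComp_iff.1 hD
  exact fun x hx => (mem_compOf.1 hx).1

theorem const_of_reach {ends : ε → Sym2 V} {A : Finset V} {ι : Type} (κ : V → ι)
    (hκ : ∀ a ∈ A, ∀ b ∈ A, (∃ e, ends e = s(a, b)) → κ a = κ b) {v w : V}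
    (h : MReachIn ends A v w) : κ v = κ w := by
  induction h with
  | refl => rfl
  | tail _ hbc ih => exact ih.trans (hκ _ hbc.1 _ hbc.2.1 hbc.2.2)

end comps

theorem card_filter_fiber {H V : Type} [Fintype H] [DecidableEq V] (π : H → V)
    (P : H → Prop) [DecidablePred P] (A : Finset V) :
    (Finset.univ.filter fun h => π h ∈ A ∧ P h).card =
      ∑ v ∈ A, (Finset.univ.filter fun h => π h = v ∧ P h).card := by
  rw [Finset.card_eq_sum_card_fiberwise (f := π) (t := A) (by intro h; simp; tauto)]
  refine Finset.sum_congr rfl fun v hv => ?_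
  congr 1
  ext h
  simp only [Finset.mem_filter, Finset.mem_univ, true_and]
  grind

open scoped Classical in
theorem even_of_comps {V ε : Type} [Fintype V] [Fintype ε] (ends : ε → Sym2 V)
    (A B : Finset V) (hBA : B ⊆ A) (w : V → ℕ)
    (hB : ∀ v ∈ B, compOf ends A v ⊆ B)
    (he : ∀ v ∈ B, Even (∑ x ∈ compOf ends A v, w x)) : Even (∑ v ∈ B, w v) := by
  rw [← Finset.sum_fiberwise_of_maps_to (s := B) (t := B.image (compOf ends A))
    (g := compOf ends A) (fun v hv => Finset.mem_image_of_mem _ hv)]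
  rw [even_iff_two_dvd]
  apply Finset.dvd_sum
  intro D hD
  obtain ⟨v, hv, rfl⟩ := Finset.mem_image.1 hD
  rw [← even_iff_two_dvd]
  suffices hs : B.filter (fun x => compOf ends A x = compOf ends A v) = compOf ends A v by
    rw [hs]; exact he v hv
  ext x
  rw [Finset.mem_filter]
  constructor
  · rintro ⟨h1, h2⟩
    rw [← h2]; exact self_mem_compOf (hBA h1)
  · intro h
    exact ⟨hB v hv h, (compOf_eq (mem_compOf.1 h).2).symm⟩

open scoped Classical in
theorem barrier_of_no_pm {H V ε : Type} [Fintype H] [Fintype V] [Fintype ε]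
    (ends : ε → Sym2 V)
    (σ : H → H) (hσ : ∀ h, σ (σ h) = h) (hσ' : ∀ h, σ h ≠ h)
    (π : H → V) (c : V → ℕ)
    (hadj : ∀ e a b, ends e = s(a, b) → ∃ h, π h = a ∧ π (σ h) = b)
    (hn : ∀ v, c v ≠ 0 → ∃ h, π h = v)
    (hno : ¬ ∃ M : (gadget σ hσ hσ' π c).Subgraph, M.IsPerfectMatching) :
    ∃ S T : Finset V, Disjoint S T ∧
      (∑ v ∈ S, (Finset.univ.filter fun h => π h = v).card) + ∑ v ∈ T, c v <
      (∑ v ∈ S, c v) + (Finset.univ.filter fun h => π h ∈ T ∧ π (σ h) ∈ S).card +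
      (Finset.univ.filter fun D : Finset V => MIsComp ends (Finset.univ \ (S ∪ T)) D ∧
        Odd (∑ v ∈ D, ((Finset.univ.filter fun h => π h = v).card + c v +
          (Finset.univ.filter fun h => π h = v ∧ π (σ h) ∈ T).card))).card := by
  obtain ⟨ι, _, U, κ, hcol, hcard, hmin⟩ := exists_min_cert _ hno
  have hne : Nonempty ι := by
    by_contra hcon
    rw [not_nonempty_iff] at hcon
    have : (oddCols U κ).card ≤ Fintype.card ι := Finset.card_le_univ _
    rw [Fintype.card_eq_zero] at this
    omega
  have cHH : ∀ h, Sum.inl h ∉ U → Sum.inl (σ h) ∉ U → κ (Sum.inl h) = κ (Sum.inl (σ h)) :=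
    fun h h1 h2 => hcol (Sum.inl h) (Sum.inl (σ h)) rfl h1 h2
  have cHC : ∀ h i, Sum.inl h ∉ U → Sum.inr ⟨π h, i⟩ ∉ U →
      κ (Sum.inl h) = κ (Sum.inr ⟨π h, i⟩) :=
    fun h i h1 h2 => hcol (Sum.inl h) (Sum.inr ⟨π h, i⟩) rfl h1 h2
  -- a half-edge in `U`
  have mH : ∀ h, Sum.inl h ∈ U → ∀ k, ∃ i, Sum.inr ⟨π h, i⟩ ∉ U ∧
      κ (Sum.inr ⟨π h, i⟩) ≠ k := by
    intro h hh k
    obtain ⟨y, hy1, hy2, hy3, hy4⟩ := hmin _ hh (κ (Sum.inl (σ h))) k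
    rcases y with h' | ⟨v, i⟩
    · have : h' = σ h := hy1
      subst this
      exact absurd rfl hy3
    · have : π h = v := hy1
      subst this
      exact ⟨i, hy2, hy4⟩
  have mC : ∀ v i, Sum.inr ⟨v, i⟩ ∈ U → ∀ k, ∃ h, π h = v ∧ Sum.inl h ∉ U ∧
      κ (Sum.inl h) ≠ k := by
    intro v i hh k
    obtain ⟨y, hy1, hy2, hy3, hy4⟩ := hmin _ hh k k
    rcases y with h' | p
    · exact ⟨h', hy1, hy2, hy3⟩
    · exact absurd hy1 (fun h => h)
  have A1 : ∀ h, Sum.inl h ∈ U → ∀ h', π h' = π h → Sum.inl h' ∈ U := by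
    intro h hh h' hp
    by_contra hcon
    obtain ⟨i, hi, hi'⟩ := mH h hh (κ (Sum.inl h'))
    rw [← hp] at i
    have : ∀ (v : V) (j : Fin (c v)), π h' = v → Sum.inr ⟨v, j⟩ ∉ U →
        κ (Sum.inl h') = κ (Sum.inr ⟨v, j⟩) := by
      intro v j hv hj; subst hv; exact cHC h' j hcon hj
    exact hi' (this _ _ hp hi).symm
  have A2 : ∀ h, Sum.inl h ∈ U → ∀ v i, π h = v → Sum.inr ⟨v, i⟩ ∉ U := by
    intro h hh v i hv hcon
    obtain ⟨h', h1, h2, _⟩ := mC _ _ hcon (Classical.arbitrary ι)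
    exact h2 (A1 h hh h' (h1.trans hv.symm))
  have B1 : ∀ v i, Sum.inr ⟨v, i⟩ ∈ U → ∀ j, Sum.inr ⟨v, j⟩ ∈ U := by
    intro v i hi j
    by_contra hcon
    obtain ⟨h, rfl, h2, h3⟩ := mC _ _ hi (κ (Sum.inr ⟨v, j⟩))
    exact h3 (cHC h j h2 hcon)
  set S : Finset V := Finset.univ.filter fun v => ∃ h, π h = v ∧ Sum.inl h ∈ U with hSdef
  set T : Finset V := Finset.univ.filter fun v => v ∉ S ∧ ∀ i, Sum.inr ⟨v, i⟩ ∈ U with hTdef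
  have hS : ∀ h, Sum.inl h ∈ U ↔ π h ∈ S := by
    intro h
    simp only [hSdef, Finset.mem_filter, Finset.mem_univ, true_and]
    constructor
    · intro hh; exact ⟨h, rfl, hh⟩
    · rintro ⟨h', h1, h2⟩; exact A1 h' h2 h h1.symm
  have hST : Disjoint S T := by
    rw [Finset.disjoint_left]
    intro v hv hv'
    simp only [hTdef, Finset.mem_filter, Finset.mem_univ, true_and] at hv'
    exact hv'.1 hv
  have hC : ∀ v i, Sum.inr ⟨v, i⟩ ∈ U ↔ v ∈ T := by
    intro v i
    constructor
    · intro hh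
      simp only [hTdef, Finset.mem_filter, Finset.mem_univ, true_and]
      refine ⟨fun hv => ?_, B1 v i hh⟩
      simp only [hSdef, Finset.mem_filter, Finset.mem_univ, true_and] at hv
      obtain ⟨h, h1, h2⟩ := hv
      exact A2 h h2 v i h1 hh
    · intro hh
      simp only [hTdef, Finset.mem_filter, Finset.mem_univ, true_and] at hh
      exact hh.2 i
  set W : Finset V := Finset.univ \ (S ∪ T) with hWdef
  have hW : ∀ v, v ∈ W ↔ v ∉ S ∧ v ∉ T := by intro v; simp [hWdef]
  have hSTd : ∀ v, v ∈ S → v ∉ T := fun v h h' => Finset.disjoint_left.1 hST h h'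
  have hUcard : U.card =
      (∑ v ∈ S, (Finset.univ.filter fun h => π h = v).card) + ∑ v ∈ T, c v := by
    have : U = (Finset.univ.filter fun h => π h ∈ S).disjSum
        (T.sigma fun v => (Finset.univ : Finset (Fin (c v)))) := by
      ext x
      rcases x with h | ⟨v, i⟩
      · simp [hS]
      · simp [hC]
    rw [this, Finset.card_disjSum, Finset.card_sigma]
    congr 1
    · have := card_filter_fiber π (fun _ => True) S
      simpa using this
    · simp
  have hWc : ∀ v ∈ W, ∃ k, (∀ i, κ (Sum.inr ⟨v, i⟩) = k) ∧
      ∀ h, π h = v → κ (Sum.inl h) = k := by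
    intro v hv
    obtain ⟨hv1, hv2⟩ := (hW v).1 hv
    have hex : ∃ i : Fin (c v), Sum.inr ⟨v, i⟩ ∉ U := by
      by_contra hcon
      push Not at hcon
      exact hv2 (by simp only [hTdef, Finset.mem_filter, Finset.mem_univ, true_and]
                    exact ⟨hv1, hcon⟩)
    obtain ⟨i0, hi0⟩ := hex
    have hc0 : c v ≠ 0 := by have := i0.2; omega
    obtain ⟨h0, rfl⟩ := hn v hc0
    have hall : ∀ i, κ (Sum.inl h0) = κ (Sum.inr ⟨π h0, i⟩) := by
      intro i
      apply cHC
      · rw [hS]; exact hv1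
      · rw [hC]; exact hv2
    refine ⟨κ (Sum.inl h0), fun i => (hall i).symm, ?_⟩
    intro h hh
    rw [hall i0]
    have : ∀ (v : V) (j : Fin (c v)), π h = v → Sum.inr ⟨v, j⟩ ∉ U →
        κ (Sum.inl h) = κ (Sum.inr ⟨v, j⟩) := by
      intro v j hv hj; subst hv
      refine cHC h j ?_ hj
      rw [hS, hh]; exact hv1
    exact this _ _ hh hi0
  choose! κW hκC hκH using hWc
  have hκadj : ∀ a ∈ W, ∀ b ∈ W, (∃ e, ends e = s(a, b)) → κW a = κW b := by
    rintro a ha b hb ⟨e, he⟩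
    obtain ⟨h, rfl, rfl⟩ := hadj e a b he
    rw [← hκH _ ha h rfl, ← hκH _ hb (σ h) rfl]
    apply cHH
    · rw [hS]; exact ((hW _).1 ha).1
    · rw [hS]; exact ((hW _).1 hb).1
  set 𝒟 := (Finset.univ.filter fun D : Finset V => MIsComp ends W D ∧
        Odd (∑ v ∈ D, ((Finset.univ.filter fun h => π h = v).card + c v +
          (Finset.univ.filter fun h => π h = v ∧ π (σ h) ∈ T).card))) with h𝒟
  let κD : Finset V → ι := fun D => if h : D.Nonempty then κW h.choose else Classical.arbitrary ι
  have hκD : ∀ v ∈ W, κD (compOf ends W v) = κW v := by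
    intro v hv
    have hne : (compOf ends W v).Nonempty := ⟨v, self_mem_compOf hv⟩
    simp only [κD, dif_pos hne]
    exact (const_of_reach κW hκadj (mem_compOf.1 hne.choose_spec).2).symm
  have hsub : oddCols U κ ⊆
      ((S.sigma fun v => (Finset.univ : Finset (Fin (c v)))).image fun p => κ (Sum.inr p)) ∪
      ((Finset.univ.filter fun h => π h ∈ T ∧ π (σ h) ∈ S).image fun h => κ (Sum.inl h)) ∪
      𝒟.image κD := by
    intro k hk
    by_contra hcon
    simp only [Finset.mem_union, not_or] at hcon
    obtain ⟨⟨n1, n2⟩, n3⟩ := hcon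
    have n1' : ∀ v i, v ∈ S → κ (Sum.inr ⟨v, i⟩) ≠ k := by
      intro v i hv hk'
      exact n1 (Finset.mem_image.2 ⟨⟨v, i⟩, by simp [hv], hk'⟩)
    have n2' : ∀ h, π h ∈ T → π (σ h) ∈ S → κ (Sum.inl h) ≠ k := by
      intro h h1 h2 hk'
      exact n2 (Finset.mem_image.2 ⟨h, by simp [h1, h2], hk'⟩)
    set B := W.filter fun v => κW v = k with hB
    have n3' : ∀ v ∈ B, Even (∑ v ∈ compOf ends W v,
        ((Finset.univ.filter fun h => π h = v).card + c v +
          (Finset.univ.filter fun h => π h = v ∧ π (σ h) ∈ T).card)) := by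
      intro v hv
      rw [← Nat.not_odd_iff_even]
      intro hodd
      rw [hB, Finset.mem_filter] at hv
      refine n3 (Finset.mem_image.2 ⟨compOf ends W v, ?_, ?_⟩)
      · rw [h𝒟, Finset.mem_filter]
        exact ⟨Finset.mem_univ _, isComp_compOf hv.1, hodd⟩
      · rw [hκD v hv.1, hv.2]
    have heven := even_of_comps ends W B (Finset.filter_subset _ _) _ (by
      intro v hv x hx
      rw [hB, Finset.mem_filter] at hv ⊢
      rw [mem_compOf] at hx
      exact ⟨hx.1, (const_of_reach κW hκadj hx.2).symm.trans hv.2⟩) n3'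
    rw [Finset.sum_add_distrib, Finset.sum_add_distrib] at heven
    simp only [oddCols, Finset.mem_filter, Finset.mem_univ, true_and] at hk
    have hclass : (Finset.univ.filter fun y => y ∉ U ∧ κ y = k) =
        ((Finset.univ.filter fun h => π h ∈ B) ∪
          ((Finset.univ.filter fun h => π h ∈ T ∧ π (σ h) ∈ T ∧ κ (Sum.inl h) = k) ∪
          (Finset.univ.filter fun h => π h ∈ T ∧ π (σ h) ∈ B))).disjSum
        (B.sigma fun v => (Finset.univ : Finset (Fin (c v)))) := by
      ext x
      rcases x with h | ⟨v, i⟩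
      · simp only [Finset.mem_filter, Finset.mem_univ, true_and, Finset.inl_mem_disjSum,
          Finset.mem_union, hS, hB]
        constructor
        · rintro ⟨h1, h2⟩
          by_cases hT : π h ∈ T
          · right
            by_cases hT2 : π (σ h) ∈ T
            · left; exact ⟨hT, hT2, h2⟩
            · right
              have hS2 : π (σ h) ∉ S := fun hs => n2' h hT hs h2
              have hw : π (σ h) ∈ W := (hW _).2 ⟨hS2, hT2⟩
              refine ⟨hT, hw, ?_⟩
              rw [← hκH _ hw _ rfl, ← cHH, h2]
              · rwa [hS]
              · rwa [hS]
          · left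
            have hw : π h ∈ W := (hW _).2 ⟨h1, hT⟩
            exact ⟨hw, by rw [← hκH _ hw _ rfl, h2]⟩
        · rintro (⟨h1, h2⟩ | ⟨h1, h2, h3⟩ | ⟨h1, h2, h3⟩)
          · exact ⟨((hW _).1 h1).1, by rw [hκH _ h1 _ rfl, h2]⟩
          · exact ⟨fun hs => hSTd _ hs h1, h3⟩
          · refine ⟨fun hs => hSTd _ hs h1, ?_⟩
            rw [cHH, hκH _ h2 _ rfl, h3]
            · rw [hS]; exact fun hs => hSTd _ hs h1
            · rw [hS]; exact ((hW _).1 h2).1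
      · simp only [Finset.mem_filter, Finset.mem_univ, true_and, Finset.inr_mem_disjSum,
          Finset.mem_sigma, and_true, hC, hB]
        constructor
        · rintro ⟨h1, h2⟩
          have hw : v ∈ W := (hW _).2 ⟨fun hs => n1' v i hs h2, h1⟩
          exact ⟨hw, by rw [← hκC v hw i, h2]⟩
        · rintro ⟨h1, h2⟩
          exact ⟨((hW _).1 h1).2, by rw [hκC v h1 i, h2]⟩
    replace hk : Odd (Finset.univ.filter fun y => y ∉ U ∧ κ y = k).card := by convert hk
    rw [hclass, Finset.card_disjSum, Finset.card_sigma, Finset.card_union_of_disjoint,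
      Finset.card_union_of_disjoint] at hk
    · have e1 : (Finset.univ.filter fun h => π h ∈ B).card =
          ∑ v ∈ B, (Finset.univ.filter fun h => π h = v).card := by
        simpa using card_filter_fiber π (fun _ => True) B
      have e2 : (Finset.univ.filter fun h => π h ∈ T ∧ π (σ h) ∈ B).card =
          ∑ v ∈ B, (Finset.univ.filter fun h => π h = v ∧ π (σ h) ∈ T).card := by
        rw [← card_filter_fiber π (fun h => π (σ h) ∈ T) B]
        refine Finset.card_nbij' σ σ ?_ ?_ ?_ ?_
        · intro h; simp only [Finset.coe_filter, Finset.mem_univ, true_and, Set.mem_ofPred_eq, hσ]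
          tauto
        · intro h; simp only [Finset.coe_filter, Finset.mem_univ, true_and, Set.mem_ofPred_eq, hσ]
          tauto
        · intro h _; exact hσ h
        · intro h _; exact hσ h
      have e3 : Even (Finset.univ.filter fun h =>
          π h ∈ T ∧ π (σ h) ∈ T ∧ κ (Sum.inl h) = k).card := by
        refine even_card_of_invol _ σ hσ hσ' ?_
        intro h
        simp only [Finset.mem_filter, Finset.mem_univ, true_and, hσ]
        rintro ⟨h1, h2, h3⟩
        refine ⟨h2, h1, ?_⟩
        rw [← cHH, h3]
        · rw [hS]; exact fun hs => hSTd _ hs h1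
        · rw [hS]; exact fun hs => hSTd _ hs h2
      rw [e1, e2] at hk
      simp only [Finset.card_univ, Fintype.card_fin] at hk
      grind
    · rw [Finset.disjoint_left]
      intro h
      simp only [Finset.mem_filter, Finset.mem_univ, true_and, hB]
      rintro ⟨_, h1, _⟩ ⟨_, h2, _⟩
      exact ((hW _).1 h2).2 h1
    · rw [Finset.disjoint_left]
      intro h
      simp only [Finset.mem_filter, Finset.mem_univ, true_and, hB, Finset.mem_union]
      rintro ⟨h1, _⟩ (⟨h2, _⟩ | ⟨h2, _⟩)
      · exact ((hW _).1 h1).2 h2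
      · exact ((hW _).1 h1).2 h2
  refine ⟨S, T, hST, ?_⟩
  rw [← hUcard]
  refine lt_of_lt_of_le hcard ((Finset.card_le_card hsub).trans ?_)
  refine (Finset.card_union_le _ _).trans (Nat.add_le_add ((Finset.card_union_le _ _).trans
    (Nat.add_le_add ?_ Finset.card_image_le)) Finset.card_image_le)
  refine Finset.card_image_le.trans ?_
  rw [Finset.card_sigma]
  simp

section darts
variable {V : Type} [Fintype V] [DecidableEq V] {ε : Type} [Fintype ε]

/-- Half-edges of the multigraph. -/
abbrev Dt (ends : ε → Sym2 V) : Type := {p : V × ε // p.1 ∈ ends p.2}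

/-- The opposite half-edge. -/
noncomputable def dflip (ends : ε → Sym2 V) (d : Dt ends) : Dt ends :=
  ⟨(Sym2.Mem.other d.2, d.1.2), Sym2.other_mem d.2⟩

theorem dflip_dflip (ends : ε → Sym2 V) (d : Dt ends) : dflip ends (dflip ends d) = d := by
  apply Subtype.ext
  apply Prod.ext
  · exact Sym2.other_invol d.2 _
  · rfl

theorem dflip_vne (ends : ε → Sym2 V) (hl : ∀ e, ¬ (ends e).IsDiag) (d : Dt ends) :
    (dflip ends d).1.1 ≠ d.1.1 := Sym2.other_ne (hl _) d.2

theorem dflip_ne (ends : ε → Sym2 V) (hl : ∀ e, ¬ (ends e).IsDiag) (d : Dt ends) :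
    dflip ends d ≠ d := fun h => dflip_vne ends hl d (by rw [h])

theorem dflip_edge (ends : ε → Sym2 V) (d : Dt ends) : (dflip ends d).1.2 = d.1.2 := rfl

theorem ends_dart (ends : ε → Sym2 V) (d : Dt ends) :
    ends d.1.2 = s(d.1.1, (dflip ends d).1.1) := (Sym2.other_spec d.2).symm

theorem exists_dart (ends : ε → Sym2 V) (e : ε) (a b : V) (h : ends e = s(a, b)) :
    ∃ d : Dt ends, d.1.2 = e ∧ d.1.1 = a ∧ (dflip ends d).1.1 = b := by
  have ha : a ∈ ends e := by rw [h]; exact Sym2.mem_mk_left a b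
  refine ⟨⟨(a, e), ha⟩, rfl, rfl, ?_⟩
  have := ends_dart ends ⟨(a, e), ha⟩
  simp only [h] at this
  exact (Sym2.congr_right.1 this).symm

theorem dart_eq_or (ends : ε → Sym2 V) (d d' : Dt ends) (h : d.1.2 = d'.1.2) :
    d = d' ∨ d = dflip ends d' := by
  have h1 := ends_dart ends d'
  have h2 := d.2
  rw [h, h1, Sym2.mem_iff] at h2
  rcases h2 with h2 | h2
  · left; exact Subtype.ext (Prod.ext h2 h)
  · right; exact Subtype.ext (Prod.ext h2 h)

open scoped Classical in
theorem mdegIn_eq (ends : ε → Sym2 V) (F : Finset ε) (v : V) :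
    mdegIn ends F v = (Finset.univ.filter fun d : Dt ends => d.1.1 = v ∧ d.1.2 ∈ F).card := by
  unfold mdegIn
  symm
  refine Finset.card_bij (fun d _ => d.1.2) ?_ ?_ ?_
  · rintro ⟨⟨w, e⟩, hd⟩ h
    simp only [Finset.mem_filter, Finset.mem_univ, true_and] at h ⊢
    obtain ⟨rfl, h⟩ := h
    exact ⟨h, hd⟩
  · rintro ⟨⟨w, e⟩, hd⟩ h ⟨⟨w', e'⟩, hd'⟩ h' he
    simp only [Finset.mem_filter, Finset.mem_univ, true_and] at h h' he
    apply Subtype.ext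
    apply Prod.ext
    · exact h.1.trans h'.1.symm
    · exact he
  · intro e he
    simp only [Finset.mem_filter] at he
    exact ⟨⟨(v, e), he.2⟩, by simp [he.1], rfl⟩

open scoped Classical in
theorem mdeg_eq (ends : ε → Sym2 V) (v : V) :
    mdeg ends v = (Finset.univ.filter fun d : Dt ends => d.1.1 = v).card := by
  have := mdegIn_eq ends Finset.univ v
  simp only [Finset.mem_univ, and_true] at this
  exact this

open scoped Classical in
theorem eM_eq (ends : ε → Sym2 V) (A B : Finset V) (hAB : Disjoint A B) :
    eM ends A B =
      (Finset.univ.filter fun d : Dt ends => d.1.1 ∈ A ∧ (dflip ends d).1.1 ∈ B).card := by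
  unfold eM
  symm
  refine Finset.card_bij (fun d _ => d.1.2) ?_ ?_ ?_
  · intro d h
    simp only [Finset.mem_filter, Finset.mem_univ, true_and] at h ⊢
    exact ⟨_, h.1, _, h.2, ends_dart ends d⟩
  · intro d h d' h' he
    simp only [Finset.mem_filter, Finset.mem_univ, true_and] at h h'
    rcases dart_eq_or ends d d' he with h1 | h1
    · exact h1
    · rw [h1] at h
      exact absurd h'.2 (Finset.disjoint_left.1 hAB h.1)
  · intro e he
    simp only [Finset.mem_filter, Finset.mem_univ, true_and] at he
    obtain ⟨a, ha, b, hb, he⟩ := he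
    obtain ⟨d, h1, h2, h3⟩ := exists_dart ends e a b he
    refine ⟨d, ?_, h1⟩
    simp only [Finset.mem_filter, Finset.mem_univ, true_and]
    rw [h2, h3]; exact ⟨ha, hb⟩

theorem card_flip (ends : ε → Sym2 V) (P : Dt ends → Prop) [DecidablePred P] [Fintype (Dt ends)] :
    (Finset.univ.filter fun d : Dt ends => P (dflip ends d)).card =
      (Finset.univ.filter fun d : Dt ends => P d).card := by
  refine Finset.card_nbij' (dflip ends) (dflip ends) ?_ ?_ ?_ ?_
  · intro h; simp
  · intro h; simp [dflip_dflip]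
  · intro h _; exact dflip_dflip _ h
  · intro h _; exact dflip_dflip _ h

open scoped Classical in
theorem qST_eq (ends : ε → Sym2 V) (f : V → ℤ) (S T : Finset V) :
    qST ends f S T = (Finset.univ.filter fun D : Finset V =>
      MIsComp ends (Finset.univ \ (S ∪ T)) D ∧
        Odd ((∑ v ∈ D, f v) + (eM ends D T : ℤ))).card := by
  unfold qST
  rw [Nat.card_eq_fintype_card, Fintype.card_subtype]

open scoped Classical in
theorem eta_nonneg_of_factor (ends : ε → Sym2 V) (hl : ∀ e, ¬ (ends e).IsDiag) (g f : V → ℤ)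
    (hF : HasParityFactor ends g f) (S T : Finset V) (hST : Disjoint S T) :
    0 ≤ eta ends g f S T := by
  obtain ⟨F, hF⟩ := hF
  set W : Finset V := Finset.univ \ (S ∪ T) with hWdef
  have hW : ∀ v, v ∈ W ↔ v ∉ S ∧ v ∉ T := by intro v; simp [hWdef]
  have hSTd : ∀ v, v ∈ S → v ∉ T := fun v h h' => Finset.disjoint_left.1 hST h h'
  set σ := dflip ends with hσ
  have hσσ : ∀ d, σ (σ d) = d := dflip_dflip ends
  have hσe : ∀ d, (σ d).1.2 = d.1.2 := dflip_edge ends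
  -- the surplus half-edges
  set X : Finset (Dt ends) := Finset.univ.filter fun d =>
    (d.1.1 ∈ S ∧ d.1.2 ∈ F) ∨ (d.1.1 ∈ T ∧ d.1.2 ∉ F) with hX
  have hXcard : (X.card : ℤ) = ∑ v ∈ S, (mdegIn ends F v : ℤ) +
      ∑ v ∈ T, ((mdeg ends v : ℤ) - mdegIn ends F v) := by
    have h1 : X = (Finset.univ.filter fun d : Dt ends => d.1.1 ∈ S ∧ d.1.2 ∈ F) ∪
        (Finset.univ.filter fun d : Dt ends => d.1.1 ∈ T ∧ d.1.2 ∉ F) := by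
      rw [hX, Finset.filter_or]
    rw [h1, Finset.card_union_of_disjoint]
    · rw [card_filter_fiber (fun d : Dt ends => d.1.1) (fun d => d.1.2 ∈ F) S,
        card_filter_fiber (fun d : Dt ends => d.1.1) (fun d => d.1.2 ∉ F) T]
      push_cast
      congr 1
      · refine Finset.sum_congr rfl fun v _ => ?_
        rw [mdegIn_eq]
      · refine Finset.sum_congr rfl fun v _ => ?_
        rw [mdegIn_eq, mdeg_eq]
        have := Finset.card_filter_add_card_filter_not
          (s := Finset.univ.filter fun d : Dt ends => d.1.1 = v) (fun d => d.1.2 ∈ F)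
        rw [Finset.filter_filter, Finset.filter_filter] at this
        rw [← this]; push_cast; ring
    · rw [Finset.disjoint_left]; intro d
      simp only [Finset.mem_filter, Finset.mem_univ, true_and]
      rintro ⟨h1, h2⟩ ⟨h3, h4⟩
      exact h4 h2
  have hsplit : (X.filter fun d => (σ d).1.1 ∈ W).card +
      (X.filter fun d => (σ d).1.1 ∉ W).card = X.card :=
    Finset.card_filter_add_card_filter_not _
  have hE : eM ends S T ≤ (X.filter fun d => (σ d).1.1 ∉ W).card := by
    rw [eM_eq ends S T hST]
    refine Finset.card_le_card_of_injOn (fun d => if d.1.2 ∈ F then d else σ d) ?_ ?_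
    · intro d hd
      simp only [Finset.coe_filter, Finset.mem_univ, true_and, Set.mem_ofPred_eq] at hd
      simp only [hX, Finset.coe_filter, Finset.mem_filter, Finset.mem_univ, true_and,
        Set.mem_ofPred_eq]
      by_cases hdF : d.1.2 ∈ F
      · rw [if_pos hdF]
        exact ⟨Or.inl ⟨hd.1, hdF⟩, fun h => ((hW _).1 h).2 hd.2⟩
      · rw [if_neg hdF, hσσ, hσe]
        exact ⟨Or.inr ⟨hd.2, hdF⟩, fun h => ((hW _).1 h).1 hd.1⟩
    · intro d hd d' hd' hdd
      simp only [Finset.coe_filter, Finset.mem_univ, true_and, Set.mem_ofPred_eq] at hd hd'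
      have he : d.1.2 = d'.1.2 := by
        have := congrArg (fun d : Dt ends => d.1.2) hdd
        simp only at this
        split_ifs at this <;> simpa [hσe] using this
      rcases dart_eq_or ends d d' he with h1 | h1
      · exact h1
      · rw [h1] at hd
        exact absurd hd'.2 (hSTd _ hd.1)
  have hq : qST ends f S T ≤ (X.filter fun d => (σ d).1.1 ∈ W).card := by
    rw [qST_eq]
    have : (Finset.univ.filter fun D : Finset V => MIsComp ends W D ∧
        Odd ((∑ v ∈ D, f v) + (eM ends D T : ℤ))) ⊆
        (X.filter fun d => (σ d).1.1 ∈ W).image fun d => compOf ends W (σ d).1.1 := by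
      intro D hD
      simp only [Finset.mem_filter, Finset.mem_univ, true_and] at hD
      obtain ⟨hD, hodd⟩ := hD
      have hDW := isComp_subset hD
      by_contra hcon
      have hno : ∀ d, d.1.1 ∈ D → σ d ∉ X := by
        intro d hd hdX
        refine hcon (Finset.mem_image.2 ⟨σ d, ?_, ?_⟩)
        · rw [Finset.mem_filter, hσσ]; exact ⟨hdX, hDW hd⟩
        · rw [hσσ]; exact (isComp_eq hD hd).symm
      have hDT : Disjoint D T := by
        rw [Finset.disjoint_left]; intro v hv; exact ((hW v).1 (hDW hv)).2
      -- darts of F leaving D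
      have h1 : (Finset.univ.filter fun d : Dt ends => d.1.1 ∈ D ∧ d.1.2 ∈ F) =
          (Finset.univ.filter fun d : Dt ends => d.1.1 ∈ D ∧ (σ d).1.1 ∈ D ∧ d.1.2 ∈ F) ∪
          (Finset.univ.filter fun d : Dt ends => d.1.1 ∈ D ∧ (σ d).1.1 ∈ T) := by
        ext d
        simp only [Finset.mem_filter, Finset.mem_univ, true_and, Finset.mem_union]
        constructor
        · rintro ⟨hd, hdF⟩
          have hn := hno d hd
          simp only [hX, Finset.mem_filter, Finset.mem_univ, true_and, hσe, not_or, not_and] at hn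
          have hs : (σ d).1.1 ∉ S := fun h => hn.1 h hdF
          by_cases ht : (σ d).1.1 ∈ T
          · exact Or.inr ⟨hd, ht⟩
          · left
            have hw : (σ d).1.1 ∈ W := (hW _).2 ⟨hs, ht⟩
            refine ⟨hd, ?_, hdF⟩
            rw [isComp_eq hD hd, mem_compOf]
            exact ⟨hw, Relation.ReflTransGen.single ⟨hDW hd, hw, d.1.2, ends_dart ends d⟩⟩
        · rintro (⟨hd, _, hdF⟩ | ⟨hd, ht⟩)
          · exact ⟨hd, hdF⟩
          · have hn := hno d hd
            simp only [hX, Finset.mem_filter, Finset.mem_univ, true_and, hσe, not_or, not_and,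
              not_not] at hn
            exact ⟨hd, hn.2 ht⟩
      have h2 := congrArg Finset.card h1
      rw [card_filter_fiber (fun d : Dt ends => d.1.1) (fun d => d.1.2 ∈ F) D,
        Finset.card_union_of_disjoint, ← eM_eq ends D T hDT] at h2
      · have h3 : Even (Finset.univ.filter fun d : Dt ends =>
            d.1.1 ∈ D ∧ (σ d).1.1 ∈ D ∧ d.1.2 ∈ F).card := by
          refine even_card_of_invol _ σ hσσ (dflip_ne ends hl) ?_
          intro d
          simp only [Finset.mem_filter, Finset.mem_univ, true_and, hσσ, hσe]
          tauto
        have h4 : (∑ v ∈ D, f v) ≡ ∑ v ∈ D, (mdegIn ends F v : ℤ) [ZMOD 2] := by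
          have : ∀ v ∈ D, f v ≡ (mdegIn ends F v : ℤ) [ZMOD 2] := fun v _ => (hF v).2.2.symm
          exact Int.ModEq.sum this
        have h5 : ∑ v ∈ D, (mdegIn ends F v : ℤ) = ((∑ v ∈ D, (Finset.univ.filter
            fun d : Dt ends => d.1.1 = v ∧ d.1.2 ∈ F).card : ℕ) : ℤ) := by
          push_cast
          exact Finset.sum_congr rfl fun v _ => by rw [mdegIn_eq]
        rw [h5, h2] at h4
        push_cast at h4
        obtain ⟨r, hr⟩ := h3
        obtain ⟨s, hs⟩ := hodd
        rw [hr] at h4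
        unfold Int.ModEq at h4
        push_cast at h4
        omega
      · rw [Finset.disjoint_left]
        intro d
        simp only [Finset.mem_filter, Finset.mem_univ, true_and]
        rintro ⟨_, h1, _⟩ ⟨_, h2⟩
        exact Finset.disjoint_left.1 hDT h1 h2
    exact (Finset.card_le_card this).trans Finset.card_image_le
  unfold eta
  have hS : ∑ v ∈ S, (mdegIn ends F v : ℤ) ≤ ∑ v ∈ S, f v :=
    Finset.sum_le_sum fun v _ => (hF v).2.1
  have hT : ∑ v ∈ T, g v ≤ ∑ v ∈ T, (mdegIn ends F v : ℤ) :=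
    Finset.sum_le_sum fun v _ => (hF v).1
  rw [Finset.sum_sub_distrib] at hXcard
  omega

end darts

theorem card_filter_sum {A B : Type} [Fintype A] [Fintype B] (P : A ⊕ B → Prop)
    [DecidablePred P] :
    (Finset.univ.filter P).card = (Finset.univ.filter fun a => P (Sum.inl a)).card +
      (Finset.univ.filter fun b => P (Sum.inr b)).card := by
  rw [← Finset.card_disjSum]
  congr 1
  ext x
  rcases x with a | b <;> simp

/-- Half-edges of the added loops. -/
abbrev LoopT {V : Type} (l : V → ℕ) : Type := Σ v : V, Fin (l v) × Bool

open scoped Classical in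
theorem factor_of_eta_nonneg {V : Type} [Fintype V] [DecidableEq V] {ε : Type} [Fintype ε]
    (ends : ε → Sym2 V) (hl : ∀ e, ¬ (ends e).IsDiag) (g f : V → ℤ)
    (hgf : ∀ v, g v ≤ f v) (hpar : ∀ v, g v ≡ f v [ZMOD 2])
    (heta : ∀ S T : Finset V, Disjoint S T → 0 ≤ eta ends g f S T) :
    HasParityFactor ends g f := by
  rename_i _ instD _
  obtain rfl : instD = fun a b => Classical.propDecidable (a = b) := Subsingleton.elim _ _
  have hg : ∀ v, g v ≤ mdeg ends v := by
    intro v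
    have := heta ∅ {v} (by simp)
    simp only [eta, Finset.sum_empty, Finset.sum_singleton] at this
    omega
  have hf : ∀ v, 0 ≤ f v := by
    intro v
    have := heta {v} ∅ (by simp)
    simp only [eta, Finset.sum_empty, Finset.sum_singleton] at this
    omega
  let l : V → ℕ := fun v => ((f v - g v) / 2).toNat
  have hlv : ∀ v, 2 * (l v : ℤ) = f v - g v := by
    intro v
    have h1 := hgf v
    have h2 := hpar v
    unfold Int.ModEq at h2
    simp only [l]
    omega
  let c : V → ℕ := fun v => ((mdeg ends v : ℤ) - g v).toNat
  have hc : ∀ v, (c v : ℤ) = mdeg ends v - g v := by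
    intro v
    have := hg v
    simp only [c]
    omega
  let σ : Dt ends ⊕ LoopT l → Dt ends ⊕ LoopT l := fun h => match h with
    | Sum.inl d => Sum.inl (dflip ends d)
    | Sum.inr x => Sum.inr ⟨x.1, x.2.1, !x.2.2⟩
  let π : Dt ends ⊕ LoopT l → V := fun h => match h with
    | Sum.inl d => d.1.1
    | Sum.inr x => x.1
  have hσ : ∀ h, σ (σ h) = h := by
    rintro (d | ⟨v, i, b⟩)
    · exact congrArg Sum.inl (dflip_dflip ends d)
    · simp [σ]
  have hσ' : ∀ h, σ h ≠ h := by
    rintro (d | ⟨v, i, b⟩)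
    · intro h
      exact dflip_ne ends hl d (Sum.inl_injective h)
    · simp [σ]
  have hloops : ∀ v, (Finset.univ.filter fun x : LoopT l => x.1 = v).card = 2 * l v := by
    intro v
    have : (Finset.univ.filter fun x : LoopT l => x.1 = v) =
        ({v} : Finset V).sigma fun v => (Finset.univ : Finset (Fin (l v) × Bool)) := by
      ext ⟨w, i⟩
      simp
    rw [this, Finset.card_sigma]
    simp [mul_comm]
  have hn : ∀ v, (Finset.univ.filter fun h => π h = v).card = mdeg ends v + 2 * l v := by
    intro v
    rw [card_filter_sum, mdeg_eq, ← hloops v]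
  by_cases hpm : ∃ M : (gadget σ hσ hσ' π c).Subgraph, M.IsPerfectMatching
  · obtain ⟨F, hF1, hF2⟩ := factor_of_pm σ hσ hσ' π c hpm
    have hmem : ∀ d : Dt ends, Sum.inl d ∈ F ↔
        d.1.2 ∈ Finset.univ.filter fun e => ∃ d' : Dt ends, d'.1.2 = e ∧ Sum.inl d' ∈ F := by
      intro d
      simp only [Finset.mem_filter, Finset.mem_univ, true_and]
      constructor
      · intro h; exact ⟨d, rfl, h⟩
      · rintro ⟨d', h1, h2⟩
        rcases dart_eq_or ends d' d h1 with h3 | h3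
        · rwa [h3] at h2
        · rw [h3] at h2
          exact (hF1 (Sum.inl d)).2 h2
    refine ⟨Finset.univ.filter fun e => ∃ d' : Dt ends, d'.1.2 = e ∧ Sum.inl d' ∈ F, ?_⟩
    intro v
    have h1 : (Finset.univ.filter fun h => h ∈ F ∧ π h = v).card + c v =
        (Finset.univ.filter fun h => π h = v).card := by convert hF2 v
    rw [hn, card_filter_sum] at h1
    have h2 : (Finset.univ.filter fun d : Dt ends =>
        (Sum.inl d : Dt ends ⊕ LoopT l) ∈ F ∧ π (Sum.inl d) = v).card =
        mdegIn ends (Finset.univ.filter fun e => ∃ d' : Dt ends, d'.1.2 = e ∧ Sum.inl d' ∈ F) v := by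
      rw [mdegIn_eq]
      congr 1
      ext d
      rw [Finset.mem_filter, Finset.mem_filter, ← hmem d]
      simp only [π]
      tauto
    rw [h2] at h1
    have h3 : Even (Finset.univ.filter fun x : LoopT l =>
        (Sum.inr x : Dt ends ⊕ LoopT l) ∈ F ∧ π (Sum.inr x) = v).card := by
      refine even_card_of_invol _ (fun x : LoopT l => ⟨x.1, x.2.1, !x.2.2⟩) ?_ ?_ ?_
      · rintro ⟨w, i, b⟩; simp
      · rintro ⟨w, i, b⟩; simp
      · intro x
        simp only [Finset.mem_filter, Finset.mem_univ, true_and]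
        rintro ⟨q1, q2⟩
        exact ⟨(hF1 (Sum.inr x)).1 q1, q2⟩
    have h4 : (Finset.univ.filter fun x : LoopT l =>
        (Sum.inr x : Dt ends ⊕ LoopT l) ∈ F ∧ π (Sum.inr x) = v).card ≤ 2 * l v := by
      rw [← hloops v]
      apply Finset.card_le_card
      intro x
      simp only [Finset.mem_filter, Finset.mem_univ, true_and]
      exact fun h => h.2
    obtain ⟨r, hr⟩ := h3
    rw [hr] at h1 h4
    have h5 := hlv v
    have h6 := hc v
    refine ⟨?_, ?_, ?_⟩
    · omega
    · omega
    · unfold Int.ModEq; omega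
  · exfalso
    obtain ⟨S, T, hST, hlt⟩ := barrier_of_no_pm ends σ hσ hσ' π c
      (by
        intro e a b he
        obtain ⟨d, _, h2, h3⟩ := exists_dart ends e a b he
        exact ⟨Sum.inl d, h2, h3⟩)
      (by
        intro v hv
        have h1 := hn v
        have h2 : (Finset.univ.filter fun h => π h = v).card ≠ 0 := by
          have := hlv v
          have := hc v
          have := hf v
          omega
        obtain ⟨h, hh⟩ := Finset.card_ne_zero.1 h2
        exact ⟨h, (Finset.mem_filter.1 hh).2⟩) hpm
    have hη := heta S T hST
    have hSTe : (Finset.univ.filter fun h => π h ∈ T ∧ π (σ h) ∈ S).card = eM ends S T := by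
      rw [card_filter_sum, eM_eq ends S T hST,
        ← card_flip ends (fun d => d.1.1 ∈ S ∧ (dflip ends d).1.1 ∈ T)]
      have : (Finset.univ.filter fun x : LoopT l => π (Sum.inr x) ∈ T ∧ π (σ (Sum.inr x)) ∈ S) = ∅ := by
        rw [Finset.filter_eq_empty_iff]
        rintro x _ ⟨q1, q2⟩
        exact Finset.disjoint_left.1 hST q2 q1
      rw [this, Finset.card_empty, add_zero]
      congr 1
      ext d
      simp only [Finset.mem_filter, Finset.mem_univ, true_and, dflip_dflip, π, σ]
      tauto
    have hq : (Finset.univ.filter fun D : Finset V => MIsComp ends (Finset.univ \ (S ∪ T)) D ∧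
        Odd (∑ v ∈ D, ((Finset.univ.filter fun h => π h = v).card + c v +
          (Finset.univ.filter fun h => π h = v ∧ π (σ h) ∈ T).card))).card ≤ qST ends f S T := by
      rw [qST_eq]
      apply Finset.card_le_card
      intro D
      simp only [Finset.mem_filter, Finset.mem_univ, true_and]
      rintro ⟨hD, hodd⟩
      have hD' : MIsComp ends (Finset.univ \ (S ∪ T)) D := by convert hD
      refine ⟨hD', ?_⟩
      have hDT : Disjoint D T := by
        rw [Finset.disjoint_left]
        intro v hv ht
        have := isComp_subset hD' hv
        simp at this
        exact this.2 ht
      rw [Finset.sum_add_distrib, ← card_filter_fiber π (fun h => π (σ h) ∈ T) D,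
        card_filter_sum] at hodd
      have h0 : (Finset.univ.filter fun x : LoopT l => π (Sum.inr x) ∈ D ∧ π (σ (Sum.inr x)) ∈ T) = ∅ := by
        rw [Finset.filter_eq_empty_iff]
        rintro x _ ⟨q1, q2⟩
        exact Finset.disjoint_left.1 hDT q1 q2
      have h1 : (Finset.univ.filter fun d : Dt ends =>
          π (Sum.inl d) ∈ D ∧ π (σ (Sum.inl d)) ∈ T).card = eM ends D T := by
        rw [eM_eq ends D T hDT]
      rw [h0, h1, Finset.card_empty, add_zero] at hodd
      have h2 : ((∑ v ∈ D, ((Finset.univ.filter fun h => π h = v).card + c v) : ℕ) : ℤ) =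
          ∑ v ∈ D, f v + 2 * ∑ v ∈ D, (c v : ℤ) := by
        push_cast
        rw [Finset.mul_sum, ← Finset.sum_add_distrib]
        refine Finset.sum_congr rfl fun v _ => ?_
        rw [hn]
        have := hlv v
        have := hc v
        push_cast
        linarith
      obtain ⟨r, hr⟩ := hodd
      refine ⟨r - ∑ v ∈ D, (c v : ℤ), ?_⟩
      have h3 := congrArg (Nat.cast : ℕ → ℤ) hr
      rw [Nat.cast_add, h2] at h3
      push_cast at h3
      linarith
    have hlt' := lt_of_lt_of_le hlt (Nat.add_le_add_left hq _)
    rw [hSTe] at hlt'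
    have h1 : ((∑ v ∈ S, (Finset.univ.filter fun h => π h = v).card : ℕ) : ℤ) =
        ∑ v ∈ S, f v + ∑ v ∈ S, (c v : ℤ) := by
      push_cast
      rw [← Finset.sum_add_distrib]
      refine Finset.sum_congr rfl fun v _ => ?_
      rw [hn]
      have := hlv v
      have := hc v
      push_cast
      linarith
    have h2 : ((∑ v ∈ T, c v : ℕ) : ℤ) = ∑ v ∈ T, (mdeg ends v : ℤ) - ∑ v ∈ T, g v := by
      push_cast
      rw [← Finset.sum_sub_distrib]
      exact Finset.sum_congr rfl fun v _ => hc v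
    have h3 : ((∑ v ∈ S, c v : ℕ) : ℤ) = ∑ v ∈ S, (c v : ℤ) := by push_cast; rfl
    unfold eta at hη
    omega

/-- **Lovász's parity `(g, f)`-factor theorem** (Theorem 2.2 of the paper): let `G` be a
multigraph and `g, f : V(G) → ℤ` with `g(v) ≤ f(v)` and `g(v) ≡ f(v) (mod 2)` for all `v`.
Then `G` has a parity `(g, f)`-factor iff for all disjoint `S, T ⊆ V(G)`,
`η(S, T) = f(S) + deg_G(T) − g(T) − e_G(S, T) − q(S, T) ≥ 0`, where `q(S, T)` is the number
of components `D` of `G − (S ∪ T)` with `f(D) + e_G(D, T)` odd. -/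
theorem stmt_8 {V : Type} [Fintype V] [DecidableEq V] {ε : Type} [Fintype ε]
    (ends : ε → Sym2 V) (hloopless : ∀ e, ¬ (ends e).IsDiag)
    (g f : V → ℤ) (hgf : ∀ v, g v ≤ f v) (hpar : ∀ v, g v ≡ f v [ZMOD 2]) :
    HasParityFactor ends g f ↔
      ∀ S T : Finset V, Disjoint S T → 0 ≤ eta ends g f S T := by
  exact ⟨fun h S T hST => eta_nonneg_of_factor ends hloopless g f h S T hST,
    factor_of_eta_nonneg ends hloopless g f hgf hpar⟩
end

section
/- For all integers k, r, t with r ≥ 2, t ≥ 2 and 1 ≤ k ≤ r such that k > (2/t)·r, there exist infinitely many r-edge-connected r-regular t-uniform hypergraphs that have no Berge k-factor. -/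
open Finset

section Aux

variable {V : Type} [Fintype V] [DecidableEq V] {ε : Type} [Fintype ε]

/-- Reachability by a Berge path. -/
def BReach (edges : ε → Finset V) (E' : Finset ε) (u v : V) : Prop :=
  ∃ vs es, IsBergePath edges E' vs es ∧ vs.head? = some u ∧ vs.getLast? = some v

theorem bergePath_take {edges : ε → Finset V} {E' : Finset ε} {vs : List V} {es : List ε}
    (h : IsBergePath edges E' vs es) (i : ℕ) (hi : i < vs.length) :
    IsBergePath edges E' (vs.take (i + 1)) (es.take i) := by
  obtain ⟨h1, h2, h3, h4⟩ := h
  refine ⟨h1.sublist (List.take_sublist _ _), h2.sublist (List.take_sublist _ _), ?_, ?_⟩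
  · simp only [List.length_take]; omega
  · intro j hj hv
    simp only [List.length_take] at hj hv
    simpa only [List.getElem_take] using h4 j (by omega) (by omega)

theorem bergePath_snoc {edges : ε → Finset V} {E' : Finset ε} {vs : List V} {es : List ε}
    (h : IsBergePath edges E' vs es) {x w : V} {e : ε} (hx : vs.getLast? = some x)
    (hxe : x ∈ edges e) (hwe : w ∈ edges e) (he : e ∈ E') (hw : w ∉ vs) (hes : e ∉ es) :
    IsBergePath edges E' (vs ++ [w]) (es ++ [e]) := by
  obtain ⟨h1, h2, h3, h4⟩ := h
  refine ⟨?_, ?_, ?_, ?_⟩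
  · rw [List.nodup_append]
    refine ⟨h1, by simp, ?_⟩
    intro a ha b hb
    simp only [List.mem_singleton] at hb
    rintro rfl
    exact hw (hb ▸ ha)
  · rw [List.nodup_append]
    refine ⟨h2, by simp, ?_⟩
    intro a ha b hb
    simp only [List.mem_singleton] at hb
    rintro rfl
    exact hes (hb ▸ ha)
  · simp [h3]
  · intro i hi hv
    simp only [List.length_append, List.length_singleton] at hi hv
    by_cases hlt : i < es.length
    · have := h4 i hlt (by omega)
      rw [List.getElem_append_left hlt, List.getElem_append_left (by omega),
        List.getElem_append_left (by omega)]
      exact this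
    · have hie : i = es.length := by omega
      subst hie
      rw [List.getLast?_eq_getElem?] at hx
      have hx' : vs[es.length]? = some x := by
        rw [← hx]; congr 1; omega
      obtain ⟨hb, hx''⟩ := List.getElem?_eq_some_iff.1 hx'
      rw [List.getElem_append_right (le_refl _), List.getElem_append_left hb,
        List.getElem_append_right (by omega)]
      simp [hx'', he, hxe, hwe]

theorem breach_step {edges : ε → Finset V} {E' : Finset ε} {u x w : V} {e : ε}
    (h : BReach edges E' u x) (he : e ∈ E') (hxe : x ∈ edges e) (hwe : w ∈ edges e) :
    BReach edges E' u w := by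
  obtain ⟨vs, es, hp, hu, hx⟩ := h
  have hlen := hp.2.2.1
  have hpre : ∀ i (hi : i < vs.length), (vs.take (i + 1)).head? = some u ∧
      (vs.take (i + 1)).getLast? = some (vs[i]) := by
    intro i hi
    constructor
    · rw [List.head?_take]; simp [hu]
    · rw [List.getLast?_eq_getElem?, List.length_take]
      rw [show min (i + 1) vs.length - 1 = i by omega]
      rw [List.getElem?_take_of_lt (by omega)]
      simp [hi]
  by_cases hw : w ∈ vs
  · obtain ⟨i, hi, rfl⟩ := List.getElem_of_mem hw
    exact ⟨_, _, bergePath_take hp i hi, (hpre i hi).1, (hpre i hi).2⟩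
  by_cases hes : e ∈ es
  · obtain ⟨i, hi, rfl⟩ := List.getElem_of_mem hes
    have hi' : i < vs.length := by omega
    have h4 := hp.2.2.2 i hi (by omega)
    refine ⟨vs.take (i + 1) ++ [w], es.take i ++ [es[i]],
      bergePath_snoc (bergePath_take hp i hi') (hpre i hi').2 h4.2.1 hwe he ?_ ?_, ?_, ?_⟩
    · exact fun h => hw (List.mem_of_mem_take h)
    · intro h
      obtain ⟨j, hj, hje⟩ := List.getElem_of_mem h
      rw [List.length_take] at hj
      rw [List.getElem_take] at hje
      have := (List.Nodup.getElem_inj_iff hp.2.1).1 hje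
      omega
    · rw [List.head?_append, (hpre i hi').1]; rfl
    · simp
  · refine ⟨vs ++ [w], es ++ [e], bergePath_snoc hp hx hxe hwe he hw hes, ?_, ?_⟩
    · rw [List.head?_append, hu]; rfl
    · simp

theorem edgeConn_of_cut [DecidableEq ε] (edges : ε → Finset V) (r : ℕ) (hr : 1 ≤ r)
    (hcut : ∀ S : Finset V, S.Nonempty → S ≠ Finset.univ →
      r ≤ (Finset.univ.filter fun e =>
        (∃ x ∈ edges e, x ∈ S) ∧ (∃ y ∈ edges e, y ∉ S)).card) :
    HEdgeConnected edges r := by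
  classical
  intro F hF u v
  change BReach edges _ u v
  by_contra hv
  let S : Finset V := Finset.univ.filter fun x => BReach edges (Finset.univ \ F) u x
  have hu : BReach edges (Finset.univ \ F) u u :=
    ⟨[u], [], ⟨by simp, by simp, by simp, by simp⟩, by simp, by simp⟩
  have h := hcut S ⟨u, by simp [S, hu]⟩ (fun h => hv (by
    have : v ∈ S := h ▸ Finset.mem_univ v
    simpa [S] using this))
  obtain ⟨e, he, heF⟩ := Finset.exists_mem_notMem_of_card_lt_card
    (lt_of_lt_of_le (by omega : F.card < r) h)
  simp only [S, Finset.mem_filter, Finset.mem_univ, true_and] at he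
  obtain ⟨⟨x, hx, hxS⟩, y, hy, hyS⟩ := he
  exact hyS (breach_step hxS (by simp [heF]) hx hy)

theorem noncross_dvd {B : Type} [Fintype B] [DecidableEq B] (p : V → B) (t : ℕ)
    (hp : ∀ b, (Finset.univ.filter fun v => p v = b).card = t) (S : Finset V) (b : B) :
    ((∃ x, p x = b ∧ x ∈ S) ∧ (∃ y, p y = b ∧ y ∉ S)) ↔
      ¬ t ∣ (S.filter fun v => p v = b).card := by
  have hsub : (S.filter fun v => p v = b) ⊆ Finset.univ.filter fun v => p v = b :=
    Finset.filter_subset_filter _ (Finset.subset_univ _)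
  constructor
  · rintro ⟨⟨x, hx, hxS⟩, y, hy, hyS⟩ hd
    have h1 : 0 < (S.filter fun v => p v = b).card :=
      Finset.card_pos.2 ⟨x, by simp [hx, hxS]⟩
    have h2 : (S.filter fun v => p v = b).card < t := by
      rw [← hp b]
      refine Finset.card_lt_card ⟨hsub, fun h => ?_⟩
      have := h (show y ∈ _ by simp [hy])
      simp [hyS] at this
    exact absurd (Nat.le_of_dvd h1 hd) (by omega)
  · intro hd
    constructor
    · by_contra hno
      apply hd
      rw [Finset.filter_eq_empty_iff.2 (fun x hx h => hno ⟨x, h, hx⟩)]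
      simp
    · by_contra hno
      push Not at hno
      apply hd
      have : (S.filter fun v => p v = b) = Finset.univ.filter fun v => p v = b := by
        ext x
        simp only [Finset.mem_filter, Finset.mem_univ, true_and]
        exact ⟨fun h => h.2, fun h => ⟨hno x h, h⟩⟩
      rw [this, hp]

theorem layer_count {B : Type} [Fintype B] [DecidableEq B] (p : V → B) (t : ℕ)
    (hp : ∀ b, (Finset.univ.filter fun v => p v = b).card = t) (S : Finset V) :
    ((Finset.univ.filter fun b =>
      (∃ x, p x = b ∧ x ∈ S) ∧ (∃ y, p y = b ∧ y ∉ S)).card = 0 → t ∣ S.card) ∧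
    (t ∣ S.card → (Finset.univ.filter fun b =>
      (∃ x, p x = b ∧ x ∈ S) ∧ (∃ y, p y = b ∧ y ∉ S)).card ≠ 1) := by
  have hsum : S.card = ∑ b, (S.filter fun v => p v = b).card :=
    Finset.card_eq_sum_card_fiberwise (fun _ _ => by simp)
  simp only [noncross_dvd p t hp S]
  constructor
  · intro h
    rw [Finset.card_eq_zero, Finset.filter_eq_empty_iff] at h
    rw [hsum]
    exact Finset.dvd_sum fun b hb => not_not.1 (h hb)
  · intro hd h
    obtain ⟨b, hb⟩ := Finset.card_eq_one.1 h
    have hb1 : ∀ c, ¬ t ∣ (S.filter fun v => p v = c).card ↔ c = b := by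
      intro c
      have : c ∈ (Finset.univ.filter fun b => ¬ t ∣ (S.filter fun v => p v = b).card) ↔
          c ∈ ({b} : Finset B) := by rw [hb]
      simpa using this
    apply (hb1 b).2 rfl
    rw [hsum, ← Finset.add_sum_erase _ _ (Finset.mem_univ b)] at hd
    refine (Nat.dvd_add_left (Finset.dvd_sum fun c hc => ?_)).1 hd
    by_contra hc'
    exact (Finset.ne_of_mem_erase hc) ((hb1 c).1 hc')

end Aux

theorem mod_three_count (c : ℕ) (hc : c < 3) : ∀ r, 2 ≤ r →
    r ≤ 2 * Nat.count (fun j => j % 3 ≠ c) r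
  | 0, h => by omega
  | 1, h => by omega
  | 2, _ => by interval_cases c <;> decide
  | 3, _ => by interval_cases c <;> decide
  | 4, _ => by interval_cases c <;> decide
  | r + 5, _ => by
    have ih := mod_three_count c hc (r + 2) (by omega)
    rw [show r + 5 = r + 2 + 1 + 1 + 1 by omega, Nat.count_succ, Nat.count_succ, Nat.count_succ]
    split_ifs <;> omega

theorem mod_three_card (c : ℕ) (hc : c < 3) (r : ℕ) (hr : 2 ≤ r) :
    r ≤ 2 * (Finset.univ.filter fun j : Fin r => (j : ℕ) % 3 ≠ c).card := by
  have h := mod_three_count c hc r hr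
  rw [Nat.count_eq_card_filter_range, Finset.card_filter, Finset.sum_range] at h
  rw [Finset.card_filter]
  exact h

theorem no_factor {V ε : Type} [Fintype V] [DecidableEq V] [Nonempty V] [Fintype ε]
    (edges : ε → Finset V) (k r t : ℕ)
    (hc : Fintype.card ε * t = Fintype.card V * r) (hlt : 2 * r < k * t) :
    ¬ HasBergeKFactor edges k := by
  classical
  rintro ⟨E', n, ends, φ, hd, hk, -⟩
  have hn : n ≤ Fintype.card ε := by
    have := Fintype.card_congr φ
    simp only [Fintype.card_fin, Fintype.card_coe] at this
    rw [this]; exact Finset.card_le_univ _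
  have h2 : ∀ g, (Finset.univ.filter fun v => v ∈ ends g).card = 2 := by
    intro g
    have hg := hd g
    induction h : ends g using Sym2.ind with
    | _ a b =>
      rw [h] at hg
      have hab : a ≠ b := by simpa using hg
      have : (Finset.univ.filter fun v => v ∈ s(a, b)) = {a, b} := by ext; simp
      rw [this, Finset.card_pair hab]
  have hsum : ∑ v : V, (Finset.univ.filter fun g => v ∈ ends g).card =
      ∑ g, (Finset.univ.filter fun v => v ∈ ends g).card :=
    Finset.sum_card_bipartiteAbove_eq_sum_card_bipartiteBelow (fun v g => v ∈ ends g)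
  simp only [hk, h2, Finset.sum_const, Finset.card_univ, smul_eq_mul, Fintype.card_fin] at hsum
  have hV : 0 < Fintype.card V := Fintype.card_pos
  have : Fintype.card V * (k * t) ≤ Fintype.card V * (2 * r) := by
    calc Fintype.card V * (k * t) = n * 2 * t := by rw [← hsum]; ring
      _ ≤ Fintype.card ε * 2 * t := by gcongr
      _ = 2 * (Fintype.card ε * t) := by ring
      _ = Fintype.card V * (2 * r) := by rw [hc]; ring
  have := Nat.le_of_mul_le_mul_left this hV
  omega

/-- The `i`-th partition label. -/
def lab (s t : ℕ) (i : ℕ) (x : Fin (s + 1) × Fin t) : Fin (s + 1) :=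
  if (x.2 : ℕ) = i then x.1 + 1 else x.1

theorem lab_fiber (s t i : ℕ) (b : Fin (s + 1)) :
    (Finset.univ.filter fun x => lab s t i x = b).card = t := by
  have : (Finset.univ.filter fun x => lab s t i x = b) =
      Finset.univ.image (fun c : Fin t => ((if (c : ℕ) = i then b - 1 else b), c)) := by
    ext ⟨a, c⟩
    rw [Finset.mem_filter]
    simp only [lab, Finset.mem_univ, true_and, Finset.mem_image, Prod.mk.injEq]
    constructor
    · intro h
      refine ⟨c, ?_, rfl⟩
      split_ifs at h ⊢ <;> simp [← h]
    · rintro ⟨c', h, rfl⟩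
      split_ifs at h ⊢ <;> simp [← h]
  rw [this, Finset.card_image_of_injective]
  · simp
  · intro c d h
    exact (Prod.mk.inj h).2

theorem lab_conn (s t i j : ℕ) (ht : 3 ≤ t) (hi : i < 3) (hj : j < 3) (hij : i ≠ j)
    (P : Fin (s + 1) × Fin t → Prop)
    (h1 : ∀ x y, lab s t i x = lab s t i y → (P x ↔ P y))
    (h2 : ∀ x y, lab s t j x = lab s t j y → (P x ↔ P y)) (x y) : P x ↔ P y := by
  obtain ⟨l, hl, hli, hlj⟩ : ∃ l, l < 3 ∧ l ≠ i ∧ l ≠ j := by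
    refine ⟨3 - i - j, ?_, ?_, ?_⟩ <;> omega
  let L : Fin t := ⟨l, by omega⟩
  let I : Fin t := ⟨i, by omega⟩
  have hrow : ∀ a c, P (a, c) ↔ P (a, L) := by
    intro a c
    by_cases hc : (c : ℕ) = i
    · exact h2 _ _ (by simp [lab, L, hc, hij, hlj])
    · exact h1 _ _ (by simp [lab, L, hc, hli])
  have hstep : ∀ a, P (a + 1, L) ↔ P (a, L) := by
    intro a
    rw [← hrow a I]
    exact h1 _ _ (by simp [lab, L, I, hli])
  have hall : ∀ a, P (a, L) ↔ P (0, L) := by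
    intro a
    induction a using Fin.induction with
    | zero => rfl
    | succ a ih => rw [← ih, ← hstep a.castSucc, Fin.coeSucc_eq_succ]
  obtain ⟨a, c⟩ := x
  obtain ⟨a', c'⟩ := y
  rw [hrow a, hrow a', hall a, hall a']

/-- Theorem 4.1 of the paper: for all integers `k, r, t` with `r ≥ 2`, `t ≥ 2`,
`1 ≤ k ≤ r` and `k > (2/t)·r`, there exist infinitely many (i.e. with arbitrarily many
vertices) `r`-edge-connected `r`-regular `t`-uniform hypergraphs with no Berge
`k`-factor. -/
theorem stmt_11 (k r t : ℕ) (hr : 2 ≤ r) (ht : 2 ≤ t) (hk1 : 1 ≤ k) (hkr : k ≤ r)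
    (hbig : (2 / (t : ℝ)) * r < k) :
    ∀ n₀ : ℕ, ∃ (n m : ℕ) (edges : Fin m → Finset (Fin n)),
      n₀ ≤ n ∧
      (∀ e, 2 ≤ (edges e).card) ∧
      (∀ e, (edges e).card = t) ∧
      (∀ v, hdeg edges v = r) ∧
      HEdgeConnected edges r ∧
      ¬ HasBergeKFactor edges k := by
  intro s
  have hlt : 2 * r < k * t := by
    have htp : (0 : ℝ) < t := by exact_mod_cast (by omega : 0 < t)
    rw [div_mul_eq_mul_div, div_lt_iff₀ htp] at hbig
    exact_mod_cast hbig
  have ht3 : 3 ≤ t := by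
    by_contra h
    have : t = 2 := by omega
    subst this
    omega
  let eV : Fin ((s + 1) * t) ≃ Fin (s + 1) × Fin t := finProdFinEquiv.symm
  let eE : Fin (r * (s + 1)) ≃ Fin r × Fin (s + 1) := finProdFinEquiv.symm
  let p : ℕ → Fin ((s + 1) * t) → Fin (s + 1) := fun i v => lab s t i (eV v)
  have hp : ∀ i b, (Finset.univ.filter fun v => p i v = b).card = t := by
    intro i b
    refine Eq.trans ?_ (lab_fiber s t i b)
    refine Finset.card_equiv eV (fun v => ?_)
    simp [p]
  let edges : Fin (r * (s + 1)) → Finset (Fin ((s + 1) * t)) := fun f =>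
    Finset.univ.filter fun v => p (((eE f).1 : ℕ) % 3) v = (eE f).2
  have hcard : ∀ e, (edges e).card = t := fun e => hp _ _
  refine ⟨(s + 1) * t, r * (s + 1), edges, by nlinarith, fun e => by rw [hcard]; exact ht,
    hcard, ?_, ?_, ?_⟩
  · intro v
    have h : (Finset.univ.filter fun e => v ∈ edges e).card =
        (Finset.univ : Finset (Fin r)).card := by
      symm
      refine Finset.card_bij (fun j _ => eE.symm (j, p ((j : ℕ) % 3) v)) ?_ ?_ ?_
      · intro j _; simp [edges]
      · intro a _ b _ h
        exact (Prod.mk.inj (eE.symm.injective h)).1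
      · intro e he
        refine ⟨(eE e).1, Finset.mem_univ _, ?_⟩
        simp only [edges, Finset.mem_filter, Finset.mem_univ, true_and] at he
        rw [he]; simp
    rw [hdeg, h]; simp
  · refine edgeConn_of_cut edges r (by omega) ?_
    intro S hS hSu
    let c : ℕ → ℕ := fun i => (Finset.univ.filter fun b =>
      (∃ x, p i x = b ∧ x ∈ S) ∧ (∃ y, p i y = b ∧ y ∉ S)).card
    have hc0 : ∀ i, c i = 0 → t ∣ S.card := fun i => by
      convert (layer_count (p i) t (hp i) S).1
    have hc1 : ∀ i, t ∣ S.card → c i ≠ 1 := fun i => by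
      convert (layer_count (p i) t (hp i) S).2
    have hinv : ∀ i, c i = 0 → ∀ x y, p i x = p i y → (x ∈ S ↔ y ∈ S) := by
      intro i hi x y hxy
      have hi' := Finset.filter_eq_empty_iff.1 (Finset.card_eq_zero.1 hi)
      constructor
      · intro hx
        by_contra hy
        exact hi' (Finset.mem_univ (p i x)) ⟨⟨x, rfl, hx⟩, y, hxy.symm, hy⟩
      · intro hy
        by_contra hx
        exact hi' (Finset.mem_univ (p i x)) ⟨⟨y, hxy.symm, hy⟩, x, rfl, hx⟩
    have hne : ∀ i j, i < 3 → j < 3 → i ≠ j → c i = 0 → c j ≠ 0 := by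
      intro i j hi hj hij h1 h2
      obtain ⟨x, hx⟩ := hS
      apply hSu
      ext y
      simp only [Finset.mem_univ, iff_true]
      have := lab_conn s t i j ht3 hi hj hij (fun z => eV.symm z ∈ S)
        (fun a b hab => hinv i h1 _ _ (by simpa [p] using hab))
        (fun a b hab => hinv j h2 _ _ (by simpa [p] using hab)) (eV x) (eV y)
      simpa [hx] using this
    have htot : (Finset.univ.filter fun e =>
        (∃ x ∈ edges e, x ∈ S) ∧ (∃ y ∈ edges e, y ∉ S)).card =
        ∑ j : Fin r, c ((j : ℕ) % 3) := by
      have h1 : (Finset.univ.filter fun e =>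
          (∃ x ∈ edges e, x ∈ S) ∧ (∃ y ∈ edges e, y ∉ S)).card =
          (Finset.univ.filter fun q : Fin r × Fin (s + 1) =>
            (∃ x, p ((q.1 : ℕ) % 3) x = q.2 ∧ x ∈ S) ∧
            (∃ y, p ((q.1 : ℕ) % 3) y = q.2 ∧ y ∉ S)).card := by
        refine Finset.card_equiv eE (fun e => ?_)
        simp [edges]
      rw [h1, Finset.card_filter, Fintype.sum_prod_type]
      refine Finset.sum_congr rfl fun j _ => ?_
      simp only [c, Finset.card_filter]
    suffices hfin : r ≤ ∑ j : Fin r, c ((j : ℕ) % 3) by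
      rw [← htot] at hfin
      convert hfin
    by_cases hall : ∀ j : Fin r, c ((j : ℕ) % 3) ≠ 0
    · calc r = ∑ j : Fin r, 1 := by simp
        _ ≤ _ := Finset.sum_le_sum fun j _ => Nat.one_le_iff_ne_zero.2 (hall j)
    · push Not at hall
      obtain ⟨i, hi⟩ := hall
      have hdv := hc0 _ hi
      have h3 : ∀ n : ℕ, n % 3 < 3 := fun n => Nat.mod_lt _ (by norm_num)
      refine (mod_three_card ((i : ℕ) % 3) (h3 _) r hr).trans ?_
      rw [Finset.card_filter, Finset.mul_sum]
      refine Finset.sum_le_sum fun j _ => ?_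
      split_ifs with hj
      · have := hne _ _ (h3 i) (h3 j) (Ne.symm hj) hi
        have := hc1 ((j : ℕ) % 3) hdv
        omega
      · simp
  · have : Nonempty (Fin ((s + 1) * t)) := ⟨⟨0, by positivity⟩⟩
    refine no_factor edges k r t ?_ hlt
    simp only [Fintype.card_fin]; ring
end

section
/- For all integers r, λ, t with r ≥ 2, 2 ≤ λ ≤ r/2 and t ≥ 2, there exist infinitely many λ-edge-connected r-regular hypergraphs H of even order with rank at least t such that H has no Berge k-factor for any odd integer k with k < (1/λ)·r. -/
open Finset

/-- A multigraph edge has at most two endpoints; exactly two if loopless. -/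
lemma sym2_card_filter_mem {V : Type} [Fintype V] [DecidableEq V] (z : Sym2 V)
    (hz : ¬ z.IsDiag) : (Finset.univ.filter fun v => v ∈ z).card = 2 := by
  induction z with
  | _ x y =>
    have hxy : x ≠ y := by simpa using hz
    have : (Finset.univ.filter fun v => v ∈ s(x, y)) = {x, y} := by
      ext v; simp
    rw [this, Finset.card_pair hxy]

theorem stmt_12 (r lam t : ℕ) (hr : 2 ≤ r) (hlam2 : 2 ≤ lam)
    (hlamr : (lam : ℝ) ≤ (r : ℝ) / 2) (ht : 2 ≤ t) :
    ∀ n₀ : ℕ, ∃ (n m : ℕ) (edges : Fin m → Finset (Fin n)),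
      n₀ ≤ n ∧
      (∀ e, 2 ≤ (edges e).card) ∧
      Even n ∧
      (∃ e, t ≤ (edges e).card) ∧
      (∀ v, hdeg edges v = r) ∧
      HEdgeConnected edges lam ∧
      (∀ k : ℕ, Odd k → (k : ℝ) < (r : ℝ) / lam → ¬ HasBergeKFactor edges k) := by
  intro n₀
  have hlr : lam ≤ r := by
    have h0 : (0 : ℝ) ≤ r := Nat.cast_nonneg r
    have : (lam : ℝ) ≤ r := by linarith
    exact_mod_cast this
  -- `q` blocks of three vertices; `lam` copies of the whole vertex set,
  -- and `r - lam` copies of every block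
  obtain ⟨q, hq⟩ : ∃ q, q = 2 * (lam + n₀ + t) := ⟨_, rfl⟩
  let τ : Fin (q * 3) ≃ Fin q × Fin 3 := finProdFinEquiv.symm
  let σ : Fin (lam + q * (r - lam)) ≃ Fin lam ⊕ (Fin q × Fin (r - lam)) :=
    finSumFinEquiv.symm.trans (Equiv.sumCongr (Equiv.refl _) finProdFinEquiv.symm)
  let D : Fin q → Finset (Fin (q * 3)) := fun i => univ.filter fun v => (τ v).1 = i
  let E : Fin lam ⊕ (Fin q × Fin (r - lam)) → Finset (Fin (q * 3)) :=
    Sum.elim (fun _ => univ) (fun p => D p.1)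
  have hD : ∀ i, (D i).card = 3 := by
    intro i
    have : D i = (univ : Finset (Fin 3)).image (fun j => τ.symm (i, j)) := by
      ext v
      simp only [D, mem_filter, mem_univ, true_and, mem_image]
      constructor
      · intro h
        refine ⟨(τ v).2, ?_⟩
        rw [← h]
        exact τ.symm_apply_apply v
      · rintro ⟨j, rfl⟩
        rw [Equiv.apply_symm_apply]
    have hinj : Function.Injective (fun j : Fin 3 => τ.symm (i, j)) := by
      intro a b h
      exact (Prod.mk.inj (τ.symm.injective h)).2
    rw [this, card_image_of_injective _ hinj]; simp
  refine ⟨q * 3, lam + q * (r - lam), fun e => E (σ e), by omega, ?_, ?_, ?_, ?_, ?_, ?_⟩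
  · intro e
    rcases h : σ e with a | p
    · simp only [h, E, Sum.elim_inl, card_univ, Fintype.card_fin]; omega
    · simp only [h, E, Sum.elim_inr, hD]; omega
  · rw [hq]; exact ⟨(lam + n₀ + t) * 3, by ring⟩
  · refine ⟨σ.symm (Sum.inl ⟨0, by omega⟩), ?_⟩
    simp only [Equiv.apply_symm_apply, E, Sum.elim_inl, card_univ, Fintype.card_fin]
    omega
  · intro v
    unfold hdeg
    have h1 : (univ.filter fun e => v ∈ E (σ e)).card
        = ((univ : Finset (Fin lam)).disjSum
            (({(τ v).1} : Finset (Fin q)) ×ˢ (univ : Finset (Fin (r - lam))))).card := by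
      apply Finset.card_equiv σ
      intro e
      rcases h : σ e with a | p
      · simp [E, h]
      · obtain ⟨i, j⟩ := p
        simp [E, D, h, eq_comm]
    rw [h1, card_disjSum]
    simp
    omega
  · intro F hF u v
    obtain ⟨a, ha⟩ : ∃ a : Fin lam, σ.symm (Sum.inl a) ∉ F := by
      by_contra hcon
      push Not at hcon
      have h1 : (univ.image fun a : Fin lam => σ.symm (Sum.inl a)) ⊆ F := by
        intro x hx
        obtain ⟨a, -, rfl⟩ := mem_image.1 hx
        exact hcon a
      have h2 := card_le_card h1
      rw [card_image_of_injective _ (by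
        intro a b h
        simpa using h)] at h2
      simp at h2
      omega
    by_cases huv : u = v
    · subst huv
      exact ⟨[u], [], by simp [IsBergePath], by simp, by simp⟩
    · refine ⟨[u, v], [σ.symm (Sum.inl a)], ⟨by simp [huv], by simp, by simp, ?_⟩, by simp, by simp⟩
      intro i hi hv
      have : i = 0 := by simpa using hi
      subst this
      simp [E, ha]
  · rintro k hk - ⟨E', N, ends, φ, hloop, hreg, hsub⟩
    -- `G`-edges lying in copies of the whole vertex set
    let C : Finset (Fin N) := univ.filter fun g => ∃ a, σ (φ g).1 = Sum.inl a
    have hC : C.card ≤ lam := by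
      have h1 : (C.image fun g => σ (φ g).1) ⊆ (univ : Finset (Fin lam)).image Sum.inl := by
        intro x hx
        obtain ⟨g, hg, rfl⟩ := mem_image.1 hx
        obtain ⟨a, ha⟩ := (mem_filter.1 hg).2
        exact mem_image.2 ⟨a, mem_univ _, ha.symm⟩
      have h2 := card_le_card h1
      rw [card_image_of_injective _ (by
        intro a b h
        exact φ.injective (Subtype.ext (σ.injective h)))] at h2
      refine h2.trans (card_image_le.trans ?_)
      simp
    have hcover : (univ : Finset (Fin q)) ⊆
        C.biUnion fun g => (univ.filter fun v => v ∈ ends g).image fun v => (τ v).1 := by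
      intro i _
      by_contra hi
      have heven : ∀ g, Even ((D i).filter fun v => v ∈ ends g).card := by
        intro g
        rcases h : σ (φ g).1 with a | p
        · have : ((D i).filter fun v => v ∈ ends g) = ∅ := by
            ext v
            simp only [mem_filter, notMem_empty, iff_false, not_and]
            intro hv hvg
            apply hi
            refine mem_biUnion.2 ⟨g, mem_filter.2 ⟨mem_univ _, a, h⟩, mem_image.2 ⟨v, ?_, ?_⟩⟩
            · simpa using hvg
            · simpa [D] using hv
          rw [this]; simp
        · have hin : ∀ v ∈ ends g, (τ v).1 = p.1 := by
            intro v hv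
            have := hsub g v hv
            simpa [h, E, D] using this
          by_cases hp : p.1 = i
          · have : ((D i).filter fun v => v ∈ ends g) = univ.filter fun v => v ∈ ends g := by
              ext v
              simp only [D, mem_filter, mem_univ, true_and, and_iff_right_iff_imp]
              intro hv
              rw [hin v hv, hp]
            rw [this, sym2_card_filter_mem _ (hloop g)]
            exact even_two
          · have : ((D i).filter fun v => v ∈ ends g) = ∅ := by
              ext v
              simp only [D, mem_filter, mem_univ, true_and, notMem_empty, iff_false, not_and]
              intro hv hvg
              exact hp ((hin v hvg).symm.trans hv)
            rw [this]; simp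
      have hsum : ∑ v ∈ D i, (univ.filter fun g => v ∈ ends g).card
          = ∑ g, ((D i).filter fun v => v ∈ ends g).card := by
        exact Finset.sum_card_bipartiteAbove_eq_sum_card_bipartiteBelow (fun v g => v ∈ ends g)
      rw [Finset.sum_congr rfl (fun v _ => hreg v), sum_const, hD, smul_eq_mul] at hsum
      have hev : Even (3 * k) := by
        rw [hsum]
        exact Finset.even_sum _ (fun g _ => heven g)
      have hodd : Odd (3 * k) := Odd.mul (by decide) hk
      exact (Nat.not_even_iff_odd.2 hodd) hev
    have h1 := card_le_card hcover
    have h2 := Finset.card_biUnion_le_card_mul C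
      (fun g => (univ.filter fun v => v ∈ ends g).image fun v => (τ v).1) 2 (by
        intro g _
        exact card_image_le.trans (sym2_card_filter_mem _ (hloop g)).le)
    simp only [card_univ, Fintype.card_fin] at h1
    have := h1.trans h2
    omega
end
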